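/- Under assumptions (A1)–(A4) there exists a unique stationary Borel probability measure μ⋆ on (0,1), i.e. a unique Borel probability measure μ⋆ on (0,1) with Pμ⋆ = μ⋆. -/

import Mathlib

/-
Formalization of the Alsedà–Misiurewicz system setup:
`f0, f1` are the piecewise-linear interval homeomorphisms, `iter` the random
iteration along ω ∈ Σ = {0,1}^ℕ, `IsKernel` characterises the family x ↦ ℙ_x by
its values on cylinder sets, `Pop` is the Markov operator (as a set function),
`Stationary` expresses P-invariance for probability measures on (0,1), `U` is
the dual operator, and `A1`–`A4` are the assumptions of the paper.
-/

open MeasureTheory Filter Set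
open scoped ENNReal Topology

namespace AM

noncomputable def f0 (x₀ y₀ : ℝ) (x : ℝ) : ℝ :=
  if x ≤ x₀ then (y₀ / x₀) * x else ((1 - y₀) / (1 - x₀)) * (x - 1) + 1

noncomputable def f1 (x₀ y₀ : ℝ) (x : ℝ) : ℝ := 1 - f0 x₀ y₀ (1 - x)

/-- `fb b` is `f₁` if `b = true`, and `f₀` if `b = false`. -/
noncomputable def fb (x₀ y₀ : ℝ) (b : Bool) : ℝ → ℝ :=
  if b then f1 x₀ y₀ else f0 x₀ y₀

/-- `iter x₀ y₀ ω n x = f^n_ω(x) = f_{ω (n-1)} ∘ ⋯ ∘ f_{ω 0} (x)`, with `f^0_ω = id`. -/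
noncomputable def iter (x₀ y₀ : ℝ) (ω : ℕ → Bool) : ℕ → ℝ → ℝ
  | 0, x => x
  | n + 1, x => fb x₀ y₀ (ω n) (iter x₀ y₀ ω n x)

/-- `cylProb x₀ y₀ p₀ p₁ x w = p_{i₁}(x) p_{i₂}(f_{i₁} x) ⋯` for the word `w = (i₁, …, i_k)`. -/
noncomputable def cylProb (x₀ y₀ : ℝ) (p₀ p₁ : ℝ → ℝ) : ℝ → List Bool → ℝ
  | _, [] => 1
  | x, b :: w => (if b then p₁ x else p₀ x) * cylProb x₀ y₀ p₀ p₁ (fb x₀ y₀ b x) w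

/-- The cylinder set of sequences starting with the word `w`. -/
def cyl (w : List Bool) : Set (ℕ → Bool) := {ω | ∀ j : Fin w.length, ω j = w.get j}

/-- `IsKernel x₀ y₀ p₀ p₁ Pm` says that `Pm x = ℙ_x` for all `x ∈ (0,1)`, i.e. `Pm x` gives
every cylinder set its prescribed probability (this determines `Pm x` uniquely and makes it a
probability measure, since the empty word gives `Pm x univ = 1`). -/
def IsKernel (x₀ y₀ : ℝ) (p₀ p₁ : ℝ → ℝ) (Pm : ℝ → Measure (ℕ → Bool)) : Prop :=
  ∀ x ∈ Ioo (0:ℝ) 1, ∀ w : List Bool,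
    Pm x (cyl w) = ENNReal.ofReal (cylProb x₀ y₀ p₀ p₁ x w)

/-- The Markov operator `P`, as a set function:
`Pop μ A = ∫_{f₀⁻¹(A)} p₀ dμ + ∫_{f₁⁻¹(A)} p₁ dμ`. -/
noncomputable def Pop (x₀ y₀ : ℝ) (p₀ p₁ : ℝ → ℝ) (μ : Measure ℝ) (A : Set ℝ) : ℝ≥0∞ :=
  (∫⁻ x in f0 x₀ y₀ ⁻¹' A, ENNReal.ofReal (p₀ x) ∂μ) +
    ∫⁻ x in f1 x₀ y₀ ⁻¹' A, ENNReal.ofReal (p₁ x) ∂μ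

/-- A stationary (P-invariant) Borel probability measure on (0,1). -/
def Stationary (x₀ y₀ : ℝ) (p₀ p₁ : ℝ → ℝ) (μ : Measure ℝ) : Prop :=
  IsProbabilityMeasure μ ∧ μ (Ioo 0 1) = 1 ∧
    ∀ A : Set ℝ, MeasurableSet A → A ⊆ Ioo 0 1 → μ A = Pop x₀ y₀ p₀ p₁ μ A

/-- The dual operator `Uφ(x) = p₀(x) φ(f₀ x) + p₁(x) φ(f₁ x)`. -/
noncomputable def U (x₀ y₀ : ℝ) (p₀ p₁ : ℝ → ℝ) (φ : ℝ → ℝ) : ℝ → ℝ :=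
  fun x => p₀ x * φ (f0 x₀ y₀ x) + p₁ x * φ (f1 x₀ y₀ x)

/-- Assumption (A1): `1/2 < x₀ < 1` and `1/2 ≤ y₀ < x₀`. -/
def A1 (x₀ y₀ : ℝ) : Prop := 1/2 < x₀ ∧ x₀ < 1 ∧ 1/2 ≤ y₀ ∧ y₀ < x₀

/-- Assumption (A2): Dini continuity of `p₀, p₁`; `β` is a modulus of continuity for both, with
`∑ₙ β(C tⁿ) < ∞` for all `C ≥ 0`, `0 < t < 1`. (Such a `β` exists iff the least modulus of
continuity has this summability property.) -/
def A2 (p₀ p₁ : ℝ → ℝ) : Prop :=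
  ∃ β : ℝ → ℝ,
    (∀ t : ℝ, ∀ x ∈ Icc (0:ℝ) 1, ∀ y ∈ Icc (0:ℝ) 1, |x - y| ≤ t →
      |p₀ x - p₀ y| ≤ β t ∧ |p₁ x - p₁ y| ≤ β t) ∧
    (∀ C : ℝ, 0 ≤ C → ∀ t : ℝ, 0 < t → t < 1 → Summable fun n : ℕ => β (C * t ^ n))

/-- Assumption (A3): `p₀, p₁` are continuous, `p₀ + p₁ = 1`, and `0 < pᵢ < 1` on `[0,1]`. -/
def A3 (p₀ p₁ : ℝ → ℝ) : Prop :=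
  ContinuousOn p₀ (Icc 0 1) ∧ ContinuousOn p₁ (Icc 0 1) ∧
    ∀ x ∈ Icc (0:ℝ) 1, p₀ x + p₁ x = 1 ∧ 0 < p₀ x ∧ p₀ x < 1 ∧ 0 < p₁ x ∧ p₁ x < 1

/-- Assumption (A4): the average Lyapunov exponents at 0 and 1 are positive
(`a₀ = y₀/x₀`, `a₁ = (1-y₀)/(1-x₀)`). -/
def A4 (x₀ y₀ : ℝ) (p₀ p₁ : ℝ → ℝ) : Prop :=
  0 < p₀ 0 * Real.log (y₀ / x₀) + p₁ 0 * Real.log ((1 - y₀) / (1 - x₀)) ∧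
    0 < p₀ 1 * Real.log ((1 - y₀) / (1 - x₀)) + p₁ 1 * Real.log (y₀ / x₀)

end AM


namespace AM

section Averaging

variable {ι ι' Z Z' : Type*}

/-- The composition of the maps `f i` along a word, applied from left to right. -/
def follow (f : ι → Z → Z) : List ι → Z → Z
  | [], z => z
  | i :: w, z => follow f w (f i z)

lemma follow_append (f : ι → Z → Z) (v w : List ι) (z : Z) :
    follow f (v ++ w) z = follow f w (follow f v z) := by
  induction v generalizing z with
  | nil => rfl
  | cons i v ih => exact ih (f i z)

lemma follow_replicate (f : ι → Z → Z) (i : ι) (n : ℕ) (z : Z) :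
    follow f (List.replicate n i) z = (f i)^[n] z := by
  induction n generalizing z with
  | zero => rfl
  | succ n ih => exact ih (f i z)

lemma follow_semiconj {f : ι → Z → Z} {f' : ι' → Z' → Z'} (π : Z → Z') (j : ι → ι')
    (h : ∀ i z, π (f i z) = f' (j i) (π z)) (w : List ι) (z : Z) :
    π (follow f w z) = follow f' (w.map j) (π z) := by
  induction w generalizing z with
  | nil => rfl
  | cons i w ih => simp [follow, ih, h]

variable [Fintype ι]

/-- The averaging operator of the random map choosing `f i` with probability `p i z`. -/
def avg (p : ι → Z → ℝ) (f : ι → Z → Z) (ψ : Z → ℝ) (z : Z) : ℝ :=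
  ∑ i, p i z * ψ (f i z)

/-- Positive weights, bounded below by `δ`, that sum to one at every point. -/
structure IsWeight (p : ι → Z → ℝ) (δ : ℝ) : Prop where
  pos : 0 < δ
  le : ∀ i z, δ ≤ p i z
  sum : ∀ z, ∑ i, p i z = 1

variable {p : ι → Z → ℝ} {f : ι → Z → Z} {δ : ℝ}

lemma IsWeight.nonneg (hp : IsWeight p δ) (i : ι) (z : Z) : 0 ≤ p i z :=
  hp.pos.le.trans (hp.le i z)

lemma IsWeight.le_one (hp : IsWeight p δ) (i : ι) (z : Z) : p i z ≤ 1 := by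
  rw [← hp.sum z]
  exact Finset.single_le_sum (fun j _ => hp.nonneg j z) (Finset.mem_univ i)

lemma IsWeight.delta_le_one (hp : IsWeight p δ) (z : Z) : δ ≤ 1 := by
  obtain ⟨i⟩ : Nonempty ι := by
    by_contra h
    rw [not_nonempty_iff] at h
    simpa using hp.sum z
  exact (hp.le i z).trans (hp.le_one i z)

lemma avg_le_avg (hp : IsWeight p δ) {ψ χ : Z → ℝ} {z : Z}
    (h : ∀ i, ψ (f i z) ≤ χ (f i z)) : avg p f ψ z ≤ avg p f χ z :=
  Finset.sum_le_sum fun i _ => mul_le_mul_of_nonneg_left (h i) (hp.nonneg i z)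

lemma avg_affine (hp : IsWeight p δ) (a b : ℝ) (ψ : Z → ℝ) (z : Z) :
    avg p f (fun z => a + b * ψ z) z = a + b * avg p f ψ z := by
  simp only [avg, mul_add, Finset.sum_add_distrib, ← Finset.sum_mul, hp.sum, one_mul,
    Finset.mul_sum]
  congr 1
  exact Finset.sum_congr rfl fun i _ => by ring

lemma avg_const (hp : IsWeight p δ) (a : ℝ) (z : Z) : avg p f (fun _ => a) z = a := by
  simp [avg, ← Finset.sum_mul, hp.sum]

lemma iterate_avg_mono (hp : IsWeight p δ) {ψ χ : Z → ℝ} (h : ∀ z, ψ z ≤ χ z) (n : ℕ) (z : Z) :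
    (avg p f)^[n] ψ z ≤ (avg p f)^[n] χ z := by
  induction n generalizing z with
  | zero => exact h z
  | succ n ih =>
    simp only [Function.iterate_succ_apply']
    exact avg_le_avg hp fun i => ih _

lemma iterate_avg_affine (hp : IsWeight p δ) (a b : ℝ) (ψ : Z → ℝ) (n : ℕ) (z : Z) :
    (avg p f)^[n] (fun z => a + b * ψ z) z = a + b * (avg p f)^[n] ψ z := by
  induction n generalizing z with
  | zero => rfl
  | succ n ih =>
    simp only [Function.iterate_succ_apply']
    rw [← avg_affine hp]
    exact Finset.sum_congr rfl fun i _ => by rw [ih]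

lemma iterate_avg_nonneg (hp : IsWeight p δ) {ψ : Z → ℝ} (h : ∀ z, 0 ≤ ψ z) (n : ℕ) (z : Z) :
    0 ≤ (avg p f)^[n] ψ z := by
  induction n generalizing z with
  | zero => exact h z
  | succ n ih =>
    rw [Function.iterate_succ_apply']
    exact Finset.sum_nonneg fun i _ => mul_nonneg (hp.nonneg i z) (ih _)

lemma iterate_avg_le_lyapunov (hp : IsWeight p δ) {V : Z → ℝ} {γ C : ℝ} (hγ : 0 ≤ γ) (hγ1 : γ < 1)
    (hC : 0 ≤ C) (hV : ∀ z, avg p f V z ≤ γ * V z + C) (n : ℕ) (z : Z) :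
    (avg p f)^[n] V z ≤ γ ^ n * V z + C / (1 - γ) := by
  have h1 : 0 < 1 - γ := by linarith
  induction n generalizing z with
  | zero => simp; positivity
  | succ n ih =>
    rw [Function.iterate_succ_apply]
    calc (avg p f)^[n] (avg p f V) z
        ≤ (avg p f)^[n] (fun z => C + γ * V z) z :=
          iterate_avg_mono hp (fun z => by linarith [hV z]) n z
      _ = C + γ * (avg p f)^[n] V z := iterate_avg_affine hp _ _ _ _ _
      _ ≤ C + γ * (γ ^ n * V z + C / (1 - γ)) := by
          have := mul_le_mul_of_nonneg_left (ih z) hγ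
          linarith
      _ = _ := by
          field_simp
          ring

/-- If `ψ ≤ M` propagates along the maps, then the average of `ψ` after `|w|` steps is smaller
than `M` by the share of the word `w`. -/
lemma iterate_avg_le_of_follow (hp : IsWeight p δ) {ψ : Z → ℝ} {M : ℝ}
    (hM : ∀ z, ψ z ≤ M → ∀ i, ψ (f i z) ≤ M) (w : List ι) (z : Z) (hz : ψ z ≤ M) :
    (avg p f)^[w.length] ψ z ≤ M - δ ^ w.length * (M - ψ (follow f w z)) := by
  have key : ∀ n z, ψ z ≤ M → (avg p f)^[n] ψ z ≤ M := by
    intro n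
    induction n with
    | zero => exact fun z hz => hz
    | succ n ih =>
      intro z hz
      rw [Function.iterate_succ_apply', ← avg_const (f := f) hp M z]
      exact avg_le_avg hp fun i => ih _ (hM z hz i)
  have hfol : ∀ (w : List ι) z, ψ z ≤ M → ψ (follow f w z) ≤ M := by
    intro w
    induction w with
    | nil => exact fun z hz => hz
    | cons i w ih => exact fun z hz => ih _ (hM z hz i)
  induction w generalizing z with
  | nil => simp [follow]
  | cons i w ih =>
    classical
    simp only [List.length_cons, Function.iterate_succ_apply', follow]
    set n := w.length
    have h1 : avg p f ((avg p f)^[n] ψ) z ≤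
        ∑ j, (p j z * M - if j = i then p j z * (δ ^ n * (M - ψ (follow f w (f i z)))) else 0) := by
      refine Finset.sum_le_sum fun j _ => ?_
      split_ifs with hj
      · subst hj
        rw [← mul_sub]
        exact mul_le_mul_of_nonneg_left (ih _ (hM z hz j)) (hp.nonneg j z)
      · rw [sub_zero]
        exact mul_le_mul_of_nonneg_left (key n _ (hM z hz j)) (hp.nonneg j z)
    rw [Finset.sum_sub_distrib, ← Finset.sum_mul, hp.sum, Finset.sum_ite_eq' Finset.univ i] at h1
    simp only [Finset.mem_univ, if_true, one_mul] at h1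
    have h2 : 0 ≤ δ ^ n * (M - ψ (follow f w (f i z))) :=
      mul_nonneg (pow_nonneg hp.pos.le _) (sub_nonneg.2 (hfol w _ (hM z hz i)))
    have h3 := mul_le_mul_of_nonneg_right (hp.le i z) h2
    rw [pow_succ]
    linarith

lemma iterate_avg_mul_le (hp : IsWeight p δ) {d V : Z → ℝ} (hd : ∀ i z, d (f i z) ≤ d z)
    (hV : ∀ z, 0 ≤ V z) (n : ℕ) (z : Z) :
    (avg p f)^[n] (fun z => d z * V z) z ≤ d z * (avg p f)^[n] V z := by
  induction n generalizing z with
  | zero => exact le_rfl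
  | succ n ih =>
    simp only [Function.iterate_succ_apply']
    rw [avg, avg, Finset.mul_sum]
    refine Finset.sum_le_sum fun i _ => ?_
    have := mul_le_mul_of_nonneg_right (hd i z) (iterate_avg_nonneg (f := f) hp hV n (f i z))
    have := mul_le_mul_of_nonneg_left ((ih (f i z)).trans this) (hp.nonneg i z)
    linarith

lemma iterate_avg_antitone (hp : IsWeight p δ) {d : Z → ℝ} (hd : ∀ i z, d (f i z) ≤ d z)
    {m n : ℕ} (h : m ≤ n) (z : Z) : (avg p f)^[n] d z ≤ (avg p f)^[m] d z := by
  induction h with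
  | refl => exact le_rfl
  | @step n h ih =>
    refine le_trans ?_ ih
    rw [Function.iterate_succ_apply]
    refine iterate_avg_mono hp (fun z => ?_) n z
    calc avg p f d z ≤ avg p f (fun _ => d z) z := Finset.sum_le_sum fun i _ =>
          mul_le_mul_of_nonneg_left (hd i z) (hp.nonneg i z)
      _ = d z := avg_const hp _ _

lemma exists_pow_ge {l : ℝ} (hl : l < 1) (N : ℕ) : ∃ κ : ℝ, 0 < κ ∧ κ < 1 ∧ l ≤ κ ^ N := by
  have h : Tendsto (fun x : ℝ => x ^ N) (𝓝[<] 1) (𝓝 (1 ^ N)) :=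
    ((continuous_pow N).tendsto 1).mono_left nhdsWithin_le_nhds
  rw [one_pow] at h
  obtain ⟨κ, h1, h2, h3⟩ := ((h.eventually (lt_mem_nhds hl)).and
    ((Ioo_mem_nhdsLT (show (0 : ℝ) < 1 by norm_num)))).exists
  exact ⟨κ, h2, h3, h1.le⟩

/-- A function contracted in mean after `N` steps can be replaced by a comparable one which is
contracted in mean at every step. -/
lemma exists_one_step_contraction (hp : IsWeight p δ) {c : Z → ℝ} (hc : ∀ z, 0 ≤ c z) {l : ℝ}
    (hl : l < 1) {N : ℕ} (hN : ∀ z, (avg p f)^[N + 1] c z ≤ l * c z) :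
    ∃ κ, 0 < κ ∧ κ < 1 ∧ ∃ c' : Z → ℝ, (∀ z, c z ≤ c' z) ∧ (∀ z, avg p f c' z ≤ κ * c' z) ∧
      ∀ z B, (∀ n, (avg p f)^[n] c z ≤ B) → c' z ≤ (∑ j ∈ Finset.range (N + 1), (κ ^ j)⁻¹) * B := by
  obtain ⟨κ, h0, h1, hκ⟩ := exists_pow_ge hl (N + 1)
  have hnn := fun j z => iterate_avg_nonneg (f := f) hp hc j z
  refine ⟨κ, h0, h1, fun z => ∑ j ∈ Finset.range (N + 1), (κ ^ j)⁻¹ * (avg p f)^[j] c z, ?_, ?_, ?_⟩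
  · intro z
    beta_reduce
    rw [Finset.sum_range_succ']
    have : 0 ≤ ∑ j ∈ Finset.range N, (κ ^ (j + 1))⁻¹ * (avg p f)^[j + 1] c z :=
      Finset.sum_nonneg fun j _ => mul_nonneg (by positivity) (hnn _ _)
    simpa using this
  · intro z
    have h2 : avg p f (fun z => ∑ j ∈ Finset.range (N + 1), (κ ^ j)⁻¹ * (avg p f)^[j] c z) z =
        ∑ j ∈ Finset.range (N + 1), (κ ^ j)⁻¹ * (avg p f)^[j + 1] c z := by
      simp only [avg, Finset.mul_sum, Function.iterate_succ_apply']
      rw [Finset.sum_comm]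
      exact Finset.sum_congr rfl fun j _ => Finset.sum_congr rfl fun i _ => by ring
    have h3 : ∀ j, (κ ^ j)⁻¹ = κ * (κ ^ (j + 1))⁻¹ := fun j => by
      rw [pow_succ]; field_simp
    have h4 : (κ ^ (N + 1))⁻¹ * (avg p f)^[N + 1] c z ≤ c z := by
      rw [inv_mul_le_iff₀ (by positivity)]
      exact (hN z).trans (mul_le_mul_of_nonneg_right hκ (hc z))
    have h5 := Finset.sum_range_succ (fun j => (κ ^ j)⁻¹ * (avg p f)^[j] c z) (N + 1)
    have h6 := Finset.sum_range_succ' (fun j => (κ ^ j)⁻¹ * (avg p f)^[j] c z) (N + 1)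
    rw [h2, Finset.sum_congr rfl fun j _ => by rw [h3 j, mul_assoc], ← Finset.mul_sum]
    refine mul_le_mul_of_nonneg_left ?_ h0.le
    simp only [pow_zero, inv_one, one_mul, Function.iterate_zero, id_eq] at h6
    linarith
  · intro z B hB
    rw [Finset.sum_mul]
    exact Finset.sum_le_sum fun j _ => mul_le_mul_of_nonneg_left (hB j) (by positivity)

/-- A nonexpanding distance `d` which is contracted along some word of bounded length, uniformly on
sublevel sets of a Lyapunov function `V`, is dominated by a function contracted in mean. -/
lemma exists_contraction (hp : IsWeight p δ) {d V : Z → ℝ} {γ C : ℝ} (hγ : 0 ≤ γ) (hγ1 : γ < 1)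
    (hC : 0 ≤ C) (hd0 : ∀ z, 0 ≤ d z) (hV0 : ∀ z, 0 ≤ V z)
    (hV : ∀ z, avg p f V z ≤ γ * V z + C) (hd : ∀ i z, d (f i z) ≤ d z)
    (hw : ∀ R : ℝ, ∃ (N : ℕ) (l : ℝ), l < 1 ∧
      ∀ z, V z ≤ R → ∃ w : List ι, w.length ≤ N ∧ d (follow f w z) ≤ l * d z) :
    ∃ κ, 0 < κ ∧ κ < 1 ∧ ∃ (c : Z → ℝ) (A : ℝ), 0 ≤ A ∧ (∀ z, d z ≤ c z) ∧
      (∀ z, avg p f c z ≤ κ * c z) ∧ ∀ z, c z ≤ A * (d z * (1 + V z)) := by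
  rcases isEmpty_or_nonempty Z with hZ | ⟨⟨z₀⟩⟩
  · exact ⟨1 / 2, by norm_num, by norm_num, d, 0, le_rfl, fun z => le_rfl, fun z => hZ.elim z,
      fun z => hZ.elim z⟩
  have hδ1 : δ ≤ 1 := hp.delta_le_one z₀
  have hg : 0 < 1 - γ := by linarith
  set K := C / (1 - γ) with hK
  have hK0 : 0 ≤ K := by positivity
  set R := 2 * (K + 1) / (1 - γ) with hR
  have hR0 : 0 < R := by positivity
  have hRK : K ≤ (1 - γ) / 2 * R := by
    rw [hR]; field_simp; linarith
  obtain ⟨N, l, hl1, hN⟩ := hw R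
  set l₀ := max l 0
  have hl₀ : l₀ < 1 := max_lt hl1 one_pos
  set l₁ := 1 - δ ^ N * (1 - l₀) with hl₁
  have hδN : 0 < δ ^ N * (1 - l₀) := mul_pos (pow_pos hp.pos _) (by linarith)
  have hVn : ∀ n z, (avg p f)^[n] V z ≤ γ ^ n * V z + K :=
    iterate_avg_le_lyapunov hp hγ hγ1 hC hV
  have hcenter : ∀ z, V z ≤ R → (avg p f)^[N + 1] d z ≤ l₁ * d z := by
    intro z hz
    obtain ⟨w, hwN, hwd⟩ := hN z hz
    have h1 := iterate_avg_le_of_follow (ψ := d) (M := d z) hp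
      (fun y hy i => (hd i y).trans hy) w z le_rfl
    have h2 := iterate_avg_antitone (f := f) hp hd (show w.length ≤ N + 1 by omega) z
    have h3 : δ ^ N ≤ δ ^ w.length := pow_le_pow_of_le_one hp.pos.le hδ1 hwN
    have h4 : d (follow f w z) ≤ l₀ * d z :=
      hwd.trans (mul_le_mul_of_nonneg_right (le_max_left _ _) (hd0 z))
    have h5 : 0 ≤ (1 - l₀) * d z := mul_nonneg (by linarith) (hd0 z)
    have h6 : δ ^ N * ((1 - l₀) * d z) ≤ δ ^ w.length * (d z - d (follow f w z)) :=
      mul_le_mul h3 (by linarith) h5 (pow_nonneg hp.pos.le _)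
    rw [hl₁]
    linarith
  set ε := (δ ^ N * (1 - l₀)) / (2 * (R + K)) with hε
  have hε0 : 0 < ε := by positivity
  have hεR : ε * (R + K) = (1 - l₁) / 2 := by
    rw [hε, hl₁]; field_simp; ring
  clear_value ε
  set c : Z → ℝ := fun z => d z * (1 + ε * V z) with hc
  have hW0 : ∀ z, 0 ≤ 1 + ε * V z := fun z => by have := hV0 z; positivity
  have hc0 : ∀ z, 0 ≤ c z := fun z => mul_nonneg (hd0 z) (hW0 z)
  have hcn : ∀ n z, (avg p f)^[n] c z ≤ d z * (1 + ε * (V z + K)) := by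
    intro n z
    refine (iterate_avg_mul_le hp hd hW0 n z).trans (mul_le_mul_of_nonneg_left ?_ (hd0 z))
    rw [iterate_avg_affine hp]
    have h1 : γ ^ n * V z ≤ V z := mul_le_of_le_one_left (hV0 z) (pow_le_one₀ hγ hγ1.le)
    have := mul_le_mul_of_nonneg_left ((hVn n z).trans (by linarith : _ ≤ V z + K)) hε0.le
    linarith
  set l₂ := (1 + ε * ((1 + γ) / 2 * R)) / (1 + ε * R) with hl₂
  have hl₂1 : l₂ < 1 := by
    rw [hl₂, div_lt_one (by positivity)]
    have : (1 + γ) / 2 * R < R := by nlinarith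
    have := mul_lt_mul_of_pos_left this hε0
    linarith
  have hstep : ∀ z, (avg p f)^[N + 1] c z ≤ max ((1 + l₁) / 2) l₂ * c z := by
    intro z
    by_cases hz : V z ≤ R
    · have h1 : c = fun z => d z + ε * (d z * V z) := by
        ext z; simp only [hc]; ring
      have h2 : ∀ n z, (avg p f)^[n] (fun z => d z + ε * (d z * V z)) z =
          (avg p f)^[n] d z + ε * (avg p f)^[n] (fun z => d z * V z) z := by
        intro n
        induction n with
        | zero => exact fun z => rfl
        | succ n ih =>
          intro z
          simp only [Function.iterate_succ_apply']
          simp only [avg, Finset.mul_sum, ← Finset.sum_add_distrib]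
          exact Finset.sum_congr rfl fun i _ => by rw [ih]; ring
      rw [show (avg p f)^[N + 1] c z = _ from congrFun (congrArg _ h1) z, h2]
      have h3 := iterate_avg_mul_le (f := f) hp hd hV0 (N + 1) z
      have h4 : (avg p f)^[N + 1] V z ≤ R + K := by
        have := mul_le_of_le_one_left (hV0 z) (pow_le_one₀ (n := N + 1) hγ hγ1.le)
        linarith [hVn (N + 1) z]
      have h5 := mul_le_mul_of_nonneg_left (h3.trans (mul_le_mul_of_nonneg_left h4 (hd0 z))) hε0.le
      have h6 : ε * (d z * (R + K)) = (1 - l₁) / 2 * d z := by rw [← hεR]; ring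
      have h7 : (1 + l₁) / 2 * d z ≤ max ((1 + l₁) / 2) l₂ * d z :=
        mul_le_mul_of_nonneg_right (le_max_left _ _) (hd0 z)
      have h8 : max ((1 + l₁) / 2) l₂ * d z ≤ max ((1 + l₁) / 2) l₂ * c z := by
        refine mul_le_mul_of_nonneg_left ?_ (le_max_of_le_right ?_)
        · exact le_mul_of_one_le_right (hd0 z) (by linarith [mul_nonneg hε0.le (hV0 z)])
        · rw [hl₂]; positivity
      linarith [hcenter z hz]
    · push Not at hz
      refine (iterate_avg_mul_le hp hd hW0 (N + 1) z).trans ?_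
      rw [iterate_avg_affine hp, hc, mul_left_comm]
      refine mul_le_mul_of_nonneg_left ?_ (hd0 z)
      refine le_trans ?_ (mul_le_mul_of_nonneg_right (le_max_right _ _) (hW0 z))
      have h1 : (avg p f)^[N + 1] V z ≤ (1 + γ) / 2 * V z := by
        have h2 : γ ^ (N + 1) ≤ γ := by
          rw [pow_succ]; exact mul_le_of_le_one_left hγ (pow_le_one₀ hγ hγ1.le)
        have h3 := mul_le_mul_of_nonneg_right h2 (hV0 z)
        have h4 := mul_le_mul_of_nonneg_left hz.le (show 0 ≤ (1 - γ) / 2 by linarith)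
        linarith [hVn (N + 1) z]
      have h2 := mul_le_mul_of_nonneg_left h1 hε0.le
      refine (add_le_add_right h2 1).trans ?_
      rw [hl₂, div_mul_eq_mul_div _ (1 + ε * R), le_div_iff₀ (by positivity)]
      have h3 : 0 ≤ ε * (V z - R) * ((1 - γ) / 2) := by
        have : 0 ≤ V z - R := by linarith
        positivity
      nlinarith
  obtain ⟨κ, h0, h1, c', hcc, hc', hB⟩ := exists_one_step_contraction hp hc0
    (max_lt (by linarith) hl₂1) hstep
  set S := ∑ j ∈ Finset.range (N + 1), (κ ^ j)⁻¹
  have hS : 0 ≤ S := Finset.sum_nonneg fun j _ => by positivity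
  refine ⟨κ, h0, h1, c', S * (1 + ε + ε * K), by positivity, fun z => ?_, hc', fun z => ?_⟩
  · refine le_trans ?_ (hcc z)
    exact le_mul_of_one_le_right (hd0 z) (by linarith [mul_nonneg hε0.le (hV0 z)])
  · refine (hB z _ fun n => hcn n z).trans ?_
    rw [mul_assoc]
    refine mul_le_mul_of_nonneg_left ?_ hS
    rw [mul_left_comm]
    refine mul_le_mul_of_nonneg_left ?_ (hd0 z)
    have := hV0 z
    have : 0 ≤ ε * K * V z := by positivity
    nlinarith

lemma exists_follow_le (hp : IsWeight p δ) {c : Z → ℝ} {κ : ℝ} (hκ : 0 ≤ κ)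
    (hc : ∀ z, avg p f c z ≤ κ * c z) (m : ℕ) (z : Z) :
    ∃ w : List ι, w.length = m ∧ c (follow f w z) ≤ κ ^ m * c z := by
  induction m generalizing z with
  | zero => exact ⟨[], rfl, by simp [follow]⟩
  | succ m ih =>
    obtain ⟨i, hi⟩ : ∃ i, c (f i z) ≤ κ * c z := by
      by_contra! h
      have hne : (Finset.univ : Finset ι).Nonempty := by
        rw [Finset.nonempty_iff_ne_empty]
        intro h0
        simpa [h0] using hp.sum z
      have : ∑ i, p i z * (κ * c z) < avg p f c z :=
        Finset.sum_lt_sum_of_nonempty hne fun i _ =>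
          mul_lt_mul_of_pos_left (h i) (hp.pos.trans_le (hp.le i z))
      rw [← Finset.sum_mul, hp.sum, one_mul] at this
      exact absurd (hc z) (not_le.2 this)
    obtain ⟨w, hw, hwc⟩ := ih (f i z)
    refine ⟨i :: w, by simp [hw], hwc.trans ?_⟩
    rw [pow_succ, mul_assoc]
    exact mul_le_mul_of_nonneg_left hi (pow_nonneg hκ _)

/-- A sequence which is almost subinvariant, up to the modulus `β` of a distance `d` dominated by a
function `c` contracted in mean, is controlled by `c`. -/
lemma le_of_almost_subinvariant (hp : IsWeight p δ) {e : ℕ → Z → ℝ} {c d : Z → ℝ} {β : ℝ → ℝ}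
    {κ K L ω : ℝ} (hK : 0 ≤ K) (hL : 0 ≤ L) (hκ : 0 ≤ κ) (hdc : ∀ z, d z ≤ c z)
    (hc : ∀ z, avg p f c z ≤ κ * c z)
    (he : ∀ n z τ, 0 < τ → e (n + 1) z ≤ avg p f (e n) z + K * (β τ + d z / τ))
    (h0 : ∀ z, e 0 z ≤ ω + L * d z) (n : ℕ) (τ : ℕ → ℝ) (hτ : ∀ k, 0 < τ k) (z : Z) :
    e n z ≤ (ω + K * ∑ k ∈ Finset.range n, β (τ k)) +
      (K * ∑ k ∈ Finset.range n, κ ^ k / τ k + L * κ ^ n) * c z := by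
  induction n generalizing τ z with
  | zero =>
    have := mul_le_mul_of_nonneg_left (hdc z) hL
    simpa using (h0 z).trans (by linarith)
  | succ n ih =>
    have h1 := avg_le_avg (f := f) (ψ := e n) (z := z)
      (χ := fun z => (ω + K * ∑ k ∈ Finset.range n, β (τ (k + 1))) +
        (K * ∑ k ∈ Finset.range n, κ ^ k / τ (k + 1) + L * κ ^ n) * c z) hp
      fun i => ih (fun k => τ (k + 1)) (fun k => hτ _) (f i z)
    rw [avg_affine hp] at h1
    set S := K * ∑ k ∈ Finset.range n, κ ^ k / τ (k + 1) + L * κ ^ n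
    have hS : 0 ≤ S := by
      have : 0 ≤ ∑ k ∈ Finset.range n, κ ^ k / τ (k + 1) :=
        Finset.sum_nonneg fun k _ => div_nonneg (pow_nonneg hκ _) (hτ _).le
      positivity
    have h2 := mul_le_mul_of_nonneg_left (hc z) hS
    have h3 := he n z (τ 0) (hτ 0)
    have h4 : K * (d z / τ 0) ≤ K * (c z / τ 0) :=
      mul_le_mul_of_nonneg_left (div_le_div_of_nonneg_right (hdc z) (hτ 0).le) hK
    have h5 : S * κ = K * ∑ k ∈ Finset.range n, κ ^ (k + 1) / τ (k + 1) + L * κ ^ (n + 1) := by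
      simp only [S, add_mul, mul_assoc, Finset.sum_mul, pow_succ]
      congr 2
      exact Finset.sum_congr rfl fun k _ => by ring
    rw [Finset.sum_range_succ', Finset.sum_range_succ' (fun k => κ ^ k / τ k)]
    have h6 : (K * (∑ k ∈ Finset.range n, κ ^ (k + 1) / τ (k + 1) + κ ^ 0 / τ 0) +
        L * κ ^ (n + 1)) * c z = S * (κ * c z) + K * (c z / τ 0) := by
      rw [← mul_assoc S, h5]; ring
    rw [h6]
    linarith

lemma exists_follow_small (hp : IsWeight p δ) {e : ℕ → Z → ℝ} {c d : Z → ℝ} {β : ℝ → ℝ}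
    {κ K : ℝ} (hK : 0 ≤ K) (hκ : 0 < κ) (hκ1 : κ < 1) (hd0 : ∀ z, 0 ≤ d z) (hdc : ∀ z, d z ≤ c z)
    (hc : ∀ z, avg p f c z ≤ κ * c z)
    (he : ∀ n z τ, 0 < τ → e (n + 1) z ≤ avg p f (e n) z + K * (β τ + d z / τ))
    (h0 : ∀ ω > 0, ∃ L, 0 ≤ L ∧ ∀ z, e 0 z ≤ ω + L * d z) (hβ0 : ∀ t, 0 < t → 0 ≤ β t)
    (hβ : ∀ t, 0 < t → t < 1 → Summable fun n : ℕ => β (t ^ n)) {ε s : ℝ} (hε : 0 < ε)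
    (hs : 0 ≤ s) :
    ∃ m, ∀ z, c z ≤ s → ∃ w : List ι, w.length = m ∧ ∀ n, e n (follow f w z) ≤ ε := by
  obtain ⟨L, hL, hL0⟩ := h0 (ε / 3) (by positivity)
  set ρ := √κ with hρ
  have hρ0 : 0 < ρ := Real.sqrt_pos.2 hκ
  have hρ1 : ρ < 1 := by rw [hρ, Real.sqrt_lt' one_pos]; simpa
  have hρκ : ρ * ρ = κ := Real.mul_self_sqrt hκ.le
  have hb : Summable fun k => β (ρ ^ k) + s * ρ ^ k :=
    (hβ ρ hρ0 hρ1).add ((summable_geometric_of_lt_one hρ0.le hρ1).mul_left s)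
  have hb0 : ∀ k, 0 ≤ β (ρ ^ k) + s * ρ ^ k := fun k => by
    have := hβ0 (ρ ^ k) (by positivity)
    positivity
  have ht1 : Tendsto (fun m => K * ∑' k, (β (ρ ^ (k + m)) + s * ρ ^ (k + m))) atTop (𝓝 0) := by
    simpa using (tendsto_sum_nat_add fun k => β (ρ ^ k) + s * ρ ^ k).const_mul K
  have ht2 : Tendsto (fun m => L * s * κ ^ m) atTop (𝓝 0) := by
    simpa using (tendsto_pow_atTop_nhds_zero_of_lt_one hκ.le hκ1).const_mul (L * s)
  have h3 : 0 < ε / 3 := by positivity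
  obtain ⟨m, hm1, hm2⟩ :=
    ((ht1.eventually (gt_mem_nhds h3)).and (ht2.eventually (gt_mem_nhds h3))).exists
  refine ⟨m, fun z hz => ?_⟩
  obtain ⟨w, hw, hwc⟩ := exists_follow_le hp hκ.le hc m z
  refine ⟨w, hw, fun n => ?_⟩
  set y := follow f w z
  have hcy : c y ≤ κ ^ m * s := hwc.trans (mul_le_mul_of_nonneg_left hz (by positivity))
  have hc0 : 0 ≤ c y := (hd0 y).trans (hdc y)
  have h1 := le_of_almost_subinvariant hp hK hL hκ.le hdc hc he hL0 n (fun k => ρ ^ (k + m))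
    (fun k => by positivity) y
  have h4 : (∑ k ∈ Finset.range n, κ ^ k / ρ ^ (k + m)) * c y ≤
      ∑ k ∈ Finset.range n, s * ρ ^ (k + m) := by
    rw [Finset.sum_mul]
    refine Finset.sum_le_sum fun k _ => ?_
    refine (mul_le_mul_of_nonneg_left hcy (by positivity)).trans_eq ?_
    rw [div_mul_eq_mul_div, div_eq_iff (by positivity), ← hρκ]
    ring
  have h5 : κ ^ n * c y ≤ s * κ ^ m := by
    have := mul_le_of_le_one_left hc0 (pow_le_one₀ (n := n) hκ.le hκ1.le)
    linarith
  have h6 := ((summable_nat_add_iff m).2 hb).sum_le_tsum (Finset.range n)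
    (fun k _ => hb0 (k + m))
  rw [Finset.sum_add_distrib] at h6
  have h7 := mul_le_mul_of_nonneg_left h6 hK
  have h8 := mul_le_mul_of_nonneg_left h4 hK
  have h9 := mul_le_mul_of_nonneg_left h5 hL
  linarith

/-- A bounded subinvariant sequence which becomes small along some word of fixed length, uniformly
on sublevel sets of a Lyapunov function, tends to zero. -/
lemma eventually_le_of_subinvariant (hp : IsWeight p δ) {e : ℕ → Z → ℝ} {V : Z → ℝ} {γ C B : ℝ}
    (hγ : 0 ≤ γ) (hγ1 : γ < 1) (hC : 0 ≤ C) (hV0 : ∀ z, 0 ≤ V z)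
    (hV : ∀ z, avg p f V z ≤ γ * V z + C) (heB : ∀ n z, e n z ≤ B)
    (he : ∀ n z, e (n + 1) z ≤ avg p f (e n) z)
    (hsmall : ∀ ε > 0, ∀ R : ℝ, ∃ m, ∀ z, V z ≤ R →
      ∃ w : List ι, w.length = m ∧ ∀ n, e n (follow f w z) ≤ ε)
    {ε : ℝ} (hε : 0 < ε) (z : Z) : ∀ᶠ n in atTop, e n z ≤ ε := by
  classical
  have hclosed : ∀ (k : ℕ) (g : Z → ℝ), (∀ z, ∀ᶠ n in atTop, e n z ≤ g z) →
      ∀ z, ∀ᶠ n in atTop, e n z ≤ (avg p f)^[k] g z := by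
    intro k g hg
    induction k with
    | zero => exact hg
    | succ k ih =>
      intro z
      rw [Function.iterate_succ_apply']
      have h1 : ∀ᶠ n in atTop, ∀ i, e n (f i z) ≤ (avg p f)^[k] g (f i z) :=
        eventually_all.2 fun i => ih (f i z)
      obtain ⟨N, hN⟩ := eventually_atTop.1 h1
      filter_upwards [eventually_ge_atTop (N + 1)] with n hn
      obtain ⟨n, rfl⟩ : ∃ m, n = m + 1 := ⟨n - 1, by omega⟩
      exact (he n z).trans (avg_le_avg hp fun i => hN n (by omega) i)
  set K := C / (1 - γ)
  have hK : 0 ≤ K := div_nonneg hC (by linarith)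
  set R := 4 * (K + 1)
  obtain ⟨m, hm⟩ := hsmall (ε / 2) (by positivity) R
  set q := δ ^ m / 2
  have hq : 0 < q := by have := hp.pos; positivity
  have hstep : ∀ M, ε / 2 ≤ M → (∀ z, ∀ᶠ n in atTop, e n z ≤ M) →
      ∀ z, ∀ᶠ n in atTop, e n z ≤ M - q * (M - ε / 2) := by
    intro M hM h
    set g : Z → ℝ := fun z => if ∀ n, e n z ≤ ε / 2 then ε / 2 else M with hg
    have hgM : ∀ z, g z ≤ M := fun z => by simp only [hg]; split_ifs <;> linarith
    have hge : ∀ z, ∀ᶠ n in atTop, e n z ≤ g z := fun z => by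
      simp only [hg]
      split_ifs with h'
      · exact Eventually.of_forall h'
      · exact h z
    have h1 : ∀ z, (avg p f)^[m] g z ≤ (M - δ ^ m * (M - ε / 2)) + δ ^ m * (M - ε / 2) / R * V z := by
      intro z
      have hR : 0 < R := by positivity
      have hx : 0 ≤ δ ^ m * (M - ε / 2) := mul_nonneg (pow_nonneg hp.pos.le _) (by linarith)
      by_cases hz : V z ≤ R
      · obtain ⟨w, hw, hwe⟩ := hm z hz
        have := iterate_avg_le_of_follow (f := f) (ψ := g) hp (fun z _ i => hgM (f i z)) w z (hgM z)
        rw [hw, show g (follow f w z) = ε / 2 from if_pos hwe] at this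
        have h2 := mul_nonneg (div_nonneg hx hR.le) (hV0 z)
        linarith
      · have h2 := iterate_avg_mono (f := f) hp hgM m z
        have h3 : (avg p f)^[m] (fun _ => M) z = M := by
          simpa using iterate_avg_affine (f := f) hp M 0 (fun _ => 0) m z
        have h4 : δ ^ m * (M - ε / 2) ≤ δ ^ m * (M - ε / 2) / R * V z := by
          rw [div_mul_eq_mul_div, le_div_iff₀ hR]
          exact mul_le_mul_of_nonneg_left (not_le.1 hz).le hx
        linarith
    intro z
    have ht : Tendsto (fun k => γ ^ k * V z) atTop (𝓝 0) := by
      simpa using (tendsto_pow_atTop_nhds_zero_of_lt_one hγ hγ1).mul_const (V z)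
    obtain ⟨k, hk⟩ := (ht.eventually (gt_mem_nhds one_pos)).exists
    have h2 := iterate_avg_mono (f := f) hp h1 k z
    rw [iterate_avg_affine hp] at h2
    have h3 : (avg p f)^[k] V z ≤ R / 4 :=
      (iterate_avg_le_lyapunov hp hγ hγ1 hC hV k z).trans (by simp only [R]; linarith)
    filter_upwards [hclosed k _ (hclosed m g hge) z] with n hn
    refine (hn.trans h2).trans ?_
    have hx : 0 ≤ δ ^ m * (M - ε / 2) := mul_nonneg (pow_nonneg hp.pos.le _) (by linarith)
    have hR : 0 < R := by positivity
    have h4 := mul_le_mul_of_nonneg_left h3 (div_nonneg hx hR.le)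
    have h5 : δ ^ m * (M - ε / 2) / R * (R / 4) = δ ^ m * (M - ε / 2) / 4 := by
      field_simp
    have h6 : q * (M - ε / 2) = δ ^ m * (M - ε / 2) / 2 := by simp only [q]; ring
    linarith
  have hq1 : q < 1 := by
    have := pow_le_one₀ (n := m) hp.pos.le (hp.delta_le_one z)
    simp only [q]
    linarith
  set B' := max B (ε / 2)
  have hiter : ∀ k : ℕ, ∀ z, ∀ᶠ n in atTop, e n z ≤ ε / 2 + (1 - q) ^ k * (B' - ε / 2) := by
    intro k
    induction k with
    | zero =>
      refine fun z => Eventually.of_forall fun n => ?_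
      have : e n z ≤ B' := (heB n z).trans (le_max_left _ _)
      rw [pow_zero, one_mul]
      linarith
    | succ k ih =>
      intro z
      have h1 : 0 ≤ (1 - q) ^ k * (B' - ε / 2) :=
        mul_nonneg (pow_nonneg (by linarith) _) (sub_nonneg.2 (le_max_right _ _))
      filter_upwards [hstep _ (by linarith) ih z] with n hn
      refine hn.trans_eq ?_
      ring
  have ht : Tendsto (fun k => (1 - q) ^ k * (B' - ε / 2)) atTop (𝓝 0) := by
    simpa using (tendsto_pow_atTop_nhds_zero_of_lt_one (by linarith)
      (by linarith : 1 - q < 1)).mul_const (B' - ε / 2)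
  obtain ⟨k, hk⟩ := (ht.eventually (gt_mem_nhds (half_pos hε))).exists
  filter_upwards [hiter k z] with n hn
  linarith

lemma abs_iterate_avg_le (hp : IsWeight p δ) {φ : Z → ℝ} {M : ℝ} (hφ : ∀ z, |φ z| ≤ M) (n : ℕ)
    (z : Z) : |(avg p f)^[n] φ z| ≤ M := by
  have key : ∀ a : ℝ, (avg p f)^[n] (fun _ => a) z = a := fun a => by
    simpa using iterate_avg_affine (f := f) hp a 0 (fun _ => 0) n z
  rw [abs_le]
  constructor
  · rw [← key (-M)]
    exact iterate_avg_mono hp (fun z => (abs_le.1 (hφ z)).1) n z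
  · rw [← key M]
    exact iterate_avg_mono hp (fun z => (abs_le.1 (hφ z)).2) n z

lemma abs_avg_sub_avg_le (hp : IsWeight p δ) {φ : Z → ℝ} {M b : ℝ} (hφ : ∀ z, |φ z| ≤ M) {x y : Z}
    (hb : ∀ i, |p i x - p i y| ≤ b) :
    |avg p f φ x - avg p f φ y| ≤
      ∑ i, p i x * |φ (f i x) - φ (f i y)| + Fintype.card ι * M * b := by
  have h1 : avg p f φ x - avg p f φ y =
      ∑ i, (p i x * (φ (f i x) - φ (f i y)) + (p i x - p i y) * φ (f i y)) := by
    rw [avg, avg, ← Finset.sum_sub_distrib]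
    exact Finset.sum_congr rfl fun i _ => by ring
  rw [h1]
  refine (Finset.abs_sum_le_sum_abs _ _).trans ?_
  have h2 : Fintype.card ι * M * b = ∑ _i : ι, b * M := by
    simp only [Finset.sum_const, Finset.card_univ, nsmul_eq_mul]
    ring
  rw [h2, ← Finset.sum_add_distrib]
  refine Finset.sum_le_sum fun i _ => (abs_add_le _ _).trans ?_
  rw [abs_mul, abs_mul, abs_of_nonneg (hp.nonneg i x)]
  gcongr
  · exact (abs_nonneg _).trans (hb i)
  · exact hb i
  · exact hφ _

/-- The weights of two independent copies. -/
lemma IsWeight.prod (hp : IsWeight p δ) :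
    IsWeight (fun (k : ι × ι) (z : Z × Z) => p k.1 z.1 * p k.2 z.2) (δ * δ) where
  pos := mul_pos hp.pos hp.pos
  le k z := mul_le_mul (hp.le _ _) (hp.le _ _) hp.pos.le (hp.nonneg _ _)
  sum z := by
    simp only [Fintype.sum_prod_type, ← Finset.mul_sum, hp.sum, mul_one]

lemma avg_prod_add (hp : IsWeight p δ) (φ ψ : Z → ℝ) (z : Z × Z) :
    avg (fun (k : ι × ι) (z : Z × Z) => p k.1 z.1 * p k.2 z.2)
      (fun k z => (f k.1 z.1, f k.2 z.2)) (fun z => φ z.1 + ψ z.2) z =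
      avg p f φ z.1 + avg p f ψ z.2 := by
  simp only [avg, Fintype.sum_prod_type, mul_add, Finset.sum_add_distrib]
  congr 1
  · refine Finset.sum_congr rfl fun i _ => ?_
    rw [← Finset.sum_mul, ← Finset.mul_sum, hp.sum, mul_one]
  · rw [Finset.sum_comm]
    refine Finset.sum_congr rfl fun i _ => ?_
    simp only [mul_assoc]
    rw [← Finset.sum_mul, hp.sum, one_mul]

/-- Synchronization: for random maps which do not expand the distance of `h`-coordinates, contract
it along bounded words uniformly on sublevel sets of a Lyapunov function, and whose weights are
Dini continuous, the iterated averages of a function forget the initial point. -/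
theorem tendsto_iterate_avg_sub (hp : IsWeight p δ) {h V : Z → ℝ} {γ C M : ℝ} {β : ℝ → ℝ}
    {φ : Z → ℝ} (hγ : 0 ≤ γ) (hγ1 : γ < 1) (hC : 0 ≤ C) (hV0 : ∀ z, 0 ≤ V z)
    (hV : ∀ z, avg p f V z ≤ γ * V z + C)
    (hd : ∀ i x y, |h (f i x) - h (f i y)| ≤ |h x - h y|)
    (hw : ∀ R D : ℝ, ∃ (N : ℕ) (l : ℝ), l < 1 ∧ ∀ x y, V x ≤ R → |h x - h y| ≤ D →
      ∃ w : List ι, w.length ≤ N ∧ |h (follow f w x) - h (follow f w y)| ≤ l * |h x - h y|)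
    (hVh : ∀ R : ℝ, ∃ D : ℝ, ∀ x, V x ≤ R → |h x| ≤ D)
    (hpβ : ∀ τ, 0 < τ → ∀ i x y, |p i x - p i y| ≤ β τ + |h x - h y| / τ)
    (hβ0 : ∀ t, 0 < t → 0 ≤ β t)
    (hβ : ∀ t, 0 < t → t < 1 → Summable fun n : ℕ => β (t ^ n))
    (hφM : ∀ x, |φ x| ≤ M) (hφ : ∀ ω > 0, ∃ L, 0 ≤ L ∧ ∀ x y, |φ x - φ y| ≤ ω + L * |h x - h y|)
    (x y : Z) :
    Tendsto (fun n => (avg p f)^[n] φ x - (avg p f)^[n] φ y) atTop (𝓝 0) := by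
  have hM : 0 ≤ M := (abs_nonneg _).trans (hφM x)
  set e : ℕ → Z × Z → ℝ := fun n z => |(avg p f)^[n] φ z.1 - (avg p f)^[n] φ z.2| with he
  have heM : ∀ n z, e n z ≤ 2 * M := fun n z => by
    have := abs_sub ((avg p f)^[n] φ z.1) ((avg p f)^[n] φ z.2)
    linarith [abs_iterate_avg_le (f := f) hp hφM n z.1, abs_iterate_avg_le (f := f) hp hφM n z.2]
  set F : ι × ι → Z × Z → Z × Z := fun k z => (f k.1 z.1, f k.2 z.2) with hF
  have hsub : ∀ n z, e (n + 1) z ≤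
      avg (fun (k : ι × ι) (z : Z × Z) => p k.1 z.1 * p k.2 z.2) F (e n) z := by
    intro n z
    have h1 := avg_prod_add (f := f) hp ((avg p f)^[n] φ) (fun z => -(avg p f)^[n] φ z) z
    have h2 : avg p f (fun z => -(avg p f)^[n] φ z) z.2 = -avg p f ((avg p f)^[n] φ) z.2 := by
      simp [avg]
    rw [h2, ← sub_eq_add_neg] at h1
    simp only [he, Function.iterate_succ_apply']
    rw [← h1]
    refine (Finset.abs_sum_le_sum_abs _ _).trans (Finset.sum_le_sum fun k _ => ?_)
    rw [abs_mul, abs_of_nonneg (hp.prod.nonneg k z)]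
    simp only [hF, ← sub_eq_add_neg, le_refl]
  have hsmall : ∀ ε > 0, ∀ R : ℝ, ∃ m, ∀ z : Z × Z, V z.1 + V z.2 ≤ R →
      ∃ w : List (ι × ι), w.length = m ∧ ∀ n, e n (follow F w z) ≤ ε := by
    intro ε hε R
    obtain ⟨D, hD⟩ := hVh R
    let Z' := {z : Z × Z // |h z.1 - h z.2| ≤ 2 * D}
    let g : ι → Z' → Z' := fun i z => ⟨(f i z.1.1, f i z.1.2), (hd i _ _).trans z.2⟩
    have hp' : IsWeight (fun i (z : Z') => p i z.1.1) δ :=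
      ⟨hp.pos, fun i z => hp.le i _, fun z => hp.sum _⟩
    have hg1 : ∀ w (z : Z'), (follow g w z).1.1 = follow f w z.1.1 := fun w z => by
      simpa using follow_semiconj (f := g) (f' := f) (fun z : Z' => z.1.1) id (fun i z => rfl) w z
    have hg2 : ∀ w (z : Z'), (follow g w z).1.2 = follow f w z.1.2 := fun w z => by
      simpa using follow_semiconj (f := g) (f' := f) (fun z : Z' => z.1.2) id (fun i z => rfl) w z
    obtain ⟨κ, hκ, hκ1, c, A, hA, hdc, hc, hcA⟩ := exists_contraction (f := g) hp'
      (d := fun z => |h z.1.1 - h z.1.2|) (V := fun z => V z.1.1) hγ hγ1 hC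
      (fun z => abs_nonneg _) (fun z => hV0 _) (fun z => hV z.1.1) (fun i z => hd i _ _) (by
        intro R
        obtain ⟨N, l, hl, hN⟩ := hw R (2 * D)
        refine ⟨N, l, hl, fun z hz => ?_⟩
        obtain ⟨w, hwN, hwl⟩ := hN z.1.1 z.1.2 hz z.2
        exact ⟨w, hwN, by rw [hg1, hg2]; exact hwl⟩)
    by_cases hRD : 0 ≤ R ∧ 0 ≤ D
    swap
    · refine ⟨0, fun z hz => absurd ⟨?_, ?_⟩ hRD⟩
      · linarith [hV0 z.1, hV0 z.2]
      · exact (abs_nonneg _).trans (hD z.1 (by linarith [hV0 z.2]))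
    obtain ⟨hR0, hD0⟩ := hRD
    obtain ⟨m, hm⟩ := exists_follow_small (f := g) hp' (e := fun n z => e n z.1)
      (K := Fintype.card ι * M) (s := A * (2 * D * (1 + R)))
      (by positivity) hκ hκ1 (fun z => abs_nonneg _) hdc hc (by
        intro n z τ hτ
        have := abs_avg_sub_avg_le (f := f) hp (abs_iterate_avg_le (f := f) hp hφM n)
          (fun i => hpβ τ hτ i z.1.1 z.1.2)
        simp only [he, Function.iterate_succ_apply']
        exact this)
      (by
        intro ω hω
        obtain ⟨L, hL, hL'⟩ := hφ ω hω
        exact ⟨L, hL, fun z => hL' _ _⟩)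
      hβ0 hβ hε (by positivity)
    refine ⟨m, fun z hz => ?_⟩
    have h1 := hD z.1 (by linarith [hV0 z.2])
    have h2 := hD z.2 (by linarith [hV0 z.1])
    have h3 : |h z.1 - h z.2| ≤ 2 * D := by linarith [abs_sub (h z.1) (h z.2)]
    obtain ⟨w, hwm, hwe⟩ := hm ⟨z, h3⟩ ((hcA _).trans (by
      have : V z.1 ≤ R := by linarith [hV0 z.2]
      have := hV0 z.1
      gcongr))
    refine ⟨w.map fun i => (i, i), by simpa using hwm, fun n => ?_⟩
    have := follow_semiconj (f := g) (f' := F) (fun z : Z' => z.1) (fun i => (i, i))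
      (fun i z => rfl) w ⟨z, h3⟩
    rw [← this]
    exact hwe n
  rw [Metric.tendsto_atTop]
  intro ε hε
  have h1 := eventually_le_of_subinvariant (f := F) hp.prod (e := e)
    (V := fun z => V z.1 + V z.2) (C := 2 * C) hγ hγ1 (by positivity)
    (fun z => add_nonneg (hV0 _) (hV0 _))
    (fun z => by rw [avg_prod_add hp]; linarith [hV z.1, hV z.2]) heM hsub hsmall
    (half_pos hε) (x, y)
  obtain ⟨N, hN⟩ := eventually_atTop.1 h1
  refine ⟨N, fun n hn => ?_⟩
  have := hN n hn
  rw [Real.dist_eq, sub_zero]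
  exact lt_of_le_of_lt this (by linarith)

end Averaging

/-- A coordinate on `(0, 1)` in which the maps `f0` and `f1` are nonexpanding. -/
noncomputable def coord (x : ℝ) : ℝ :=
  if x ≤ 1 / 2 then Real.log (2 * x) else -Real.log (2 * (1 - x))

lemma coord_of_le {x : ℝ} (h : x ≤ 1 / 2) : coord x = Real.log (2 * x) := if_pos h

lemma coord_of_ge {x : ℝ} (h : 1 / 2 ≤ x) : coord x = -Real.log (2 * (1 - x)) := by
  rcases h.eq_or_lt with rfl | h
  · rw [coord_of_le le_rfl]; norm_num
  · exact if_neg (not_le.2 h)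

lemma coord_one_sub (x : ℝ) : coord (1 - x) = -coord x := by
  rcases le_total x (1 / 2) with h | h
  · rw [coord_of_le h, coord_of_ge (by linarith), sub_sub_cancel]
  · rw [coord_of_ge h, coord_of_le (by linarith), neg_neg]

lemma hasDerivAt_coord {x : ℝ} (hx : x ∈ Ioo (0 : ℝ) 1) :
    HasDerivAt coord (1 / min x (1 - x)) x := by
  have h0 : x ≠ 0 := hx.1.ne'
  have h1 : 1 - x ≠ 0 := by linarith [hx.2]
  have hl : HasDerivAt (fun y : ℝ => Real.log (2 * y)) (1 / x) x := by
    convert ((hasDerivAt_id' x).const_mul 2).log (by simpa using h0) using 1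
    field_simp
  have hr : HasDerivAt (fun y : ℝ => -Real.log (2 * (1 - y))) (1 / (1 - x)) x := by
    refine ((((hasDerivAt_id' x).const_sub 1).const_mul 2).log (by simpa using h1)).fun_neg.congr_deriv
      ?_
    field_simp
  rcases lt_trichotomy x (1 / 2) with h | h | h
  · rw [min_eq_left (by linarith)]
    refine hl.congr_of_eventuallyEq ?_
    filter_upwards [Iio_mem_nhds h] with y hy using coord_of_le (le_of_lt hy)
  · have e : min x (1 - x) = x := min_eq_left (by linarith)
    have e' : 1 - x = x := by linarith
    rw [e'] at hr
    rw [e]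
    have hl' : HasDerivWithinAt coord (1 / x) (Iic x) x :=
      hl.hasDerivWithinAt.congr (fun y hy => coord_of_le (hy.trans h.le)) (coord_of_le h.le)
    have hr' : HasDerivWithinAt coord (1 / x) (Ici x) x :=
      hr.hasDerivWithinAt.congr (fun y hy => coord_of_ge (h.ge.trans hy)) (coord_of_ge h.ge)
    simpa [Iic_union_Ici] using hl'.union hr'
  · rw [min_eq_right (by linarith)]
    refine hr.congr_of_eventuallyEq ?_
    filter_upwards [Ioi_mem_nhds h] with y hy using coord_of_ge (le_of_lt hy)

lemma sub_le_coord_sub {g g' : ℝ → ℝ} {l s t : ℝ} (hs : 0 < s) (ht : t < 1) (hst : s ≤ t)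
    (hg : ∀ x ∈ Icc s t, HasDerivAt g (g' x) x)
    (hl : ∀ x ∈ Icc s t, g' x * min x (1 - x) ≤ l) : g t - g s ≤ l * (coord t - coord s) := by
  have h1 : ∀ x ∈ Icc s t, HasDerivAt (fun x => l * coord x - g x)
      (l * (1 / min x (1 - x)) - g' x) x := fun x hx =>
    ((hasDerivAt_coord ⟨hs.trans_le hx.1, hx.2.trans_lt ht⟩).const_mul l).sub (hg x hx)
  have h2 : MonotoneOn (fun x => l * coord x - g x) (Icc s t) := by
    refine monotoneOn_of_hasDerivWithinAt_nonneg (convex_Icc s t)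
      (fun x hx => (h1 x hx).continuousAt.continuousWithinAt)
      (fun x hx => (h1 x (interior_subset hx)).hasDerivWithinAt) fun x hx => ?_
    have hx' := interior_subset hx
    have hm : 0 < min x (1 - x) := lt_min (hs.trans_le hx'.1) (by linarith [hx'.2])
    have := hl x hx'
    rw [← le_div_iff₀ hm] at this
    rw [mul_one_div]
    linarith
  have := h2 (left_mem_Icc.2 hst) (right_mem_Icc.2 hst) hst
  simp only at this
  linarith

lemma sub_le_coord_sub_coord {x y : ℝ} (hx : 0 < x) (hy : y < 1) (hxy : x ≤ y) :
    y - x ≤ coord y - coord x := by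
  have := sub_le_coord_sub (g := fun x => x) (g' := fun _ => 1) (l := 1) hx hy hxy
    (fun x _ => hasDerivAt_id x) fun z hz => by
      rw [one_mul]
      rcases le_total z (1 / 2) with h | h
      · exact (min_le_left _ _).trans (by linarith)
      · exact (min_le_right _ _).trans (by linarith)
  linarith

lemma coord_le_coord {x y : ℝ} (hx : 0 < x) (hy : y < 1) (hxy : x ≤ y) : coord x ≤ coord y := by
  linarith [sub_le_coord_sub_coord hx hy hxy]

lemma le_of_coord_le {x y : ℝ} (hx : x < 1) (hy : 0 < y) (h : coord x ≤ coord y) : x ≤ y := by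
  by_contra! hlt
  linarith [sub_le_coord_sub_coord hy hx hlt.le]

lemma abs_sub_le_abs_coord_sub {x y : ℝ} (hx : x ∈ Ioo (0 : ℝ) 1) (hy : y ∈ Ioo (0 : ℝ) 1) :
    |x - y| ≤ |coord x - coord y| := by
  wlog h : y ≤ x generalizing x y
  · rw [abs_sub_comm, abs_sub_comm (coord x)]
    exact this hy hx (le_of_not_ge h)
  rw [abs_of_nonneg (by linarith), abs_of_nonneg (by linarith [coord_le_coord hy.1 hx.2 h])]
  exact sub_le_coord_sub_coord hy.1 hx.2 h

section Maps

variable {x₀ y₀ : ℝ}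

lemma A1.slope (hA : A1 x₀ y₀) : 0 < y₀ / x₀ ∧ y₀ / x₀ < 1 ∧ y₀ / x₀ * x₀ = y₀ := by
  obtain ⟨h1, h2, h3, h4⟩ := hA
  have : 0 < x₀ := by linarith
  refine ⟨div_pos (by linarith) this, (div_lt_one this).2 h4, div_mul_cancel₀ _ this.ne'⟩

lemma A1.slope' (hA : A1 x₀ y₀) :
    1 < (1 - y₀) / (1 - x₀) ∧ (1 - y₀) / (1 - x₀) * (1 - x₀) = 1 - y₀ := by
  obtain ⟨h1, h2, h3, h4⟩ := hA
  have : 0 < 1 - x₀ := by linarith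
  exact ⟨(one_lt_div this).2 (by linarith), div_mul_cancel₀ _ this.ne'⟩

lemma f0_of_le {x : ℝ} (h : x ≤ x₀) : f0 x₀ y₀ x = y₀ / x₀ * x := if_pos h

lemma f0_of_ge (hA : A1 x₀ y₀) {x : ℝ} (h : x₀ ≤ x) :
    f0 x₀ y₀ x = 1 - (1 - y₀) / (1 - x₀) * (1 - x) := by
  rcases h.eq_or_lt with rfl | h
  · rw [f0_of_le le_rfl, hA.slope.2.2, hA.slope'.2]; ring
  · rw [f0, if_neg (not_le.2 h)]; ring

lemma f1_one_sub (x : ℝ) : f1 x₀ y₀ (1 - x) = 1 - f0 x₀ y₀ x := by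
  rw [f1, sub_sub_cancel]

lemma strictMono_f0 (hA : A1 x₀ y₀) : StrictMono (f0 x₀ y₀) := by
  obtain ⟨h1, -, -⟩ := hA.slope
  obtain ⟨h2, -⟩ := hA.slope'
  have hl : StrictMonoOn (f0 x₀ y₀) (Iic x₀) := fun x hx y hy h => by
    rw [f0_of_le hx, f0_of_le hy]
    exact mul_lt_mul_of_pos_left h h1
  have hr : StrictMonoOn (f0 x₀ y₀) (Ici x₀) := fun x hx y hy h => by
    rw [f0_of_ge hA hx, f0_of_ge hA hy]
    have := mul_lt_mul_of_pos_left (sub_lt_sub_left h 1) (zero_lt_one.trans h2)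
    linarith
  exact hl.Iic_union_Ici hr

lemma continuous_f0 (hA : A1 x₀ y₀) : Continuous (f0 x₀ y₀) := by
  refine Continuous.if_le (by fun_prop) (by fun_prop) continuous_id continuous_const ?_
  rintro x rfl
  rw [hA.slope.2.2]
  linarith [hA.slope'.2]

lemma f0_mem (hA : A1 x₀ y₀) {x : ℝ} (hx : x ∈ Ioo (0 : ℝ) 1) : f0 x₀ y₀ x ∈ Ioo (0 : ℝ) 1 := by
  have h0 : f0 x₀ y₀ 0 = 0 := by rw [f0_of_le (by linarith [hA.1]), mul_zero]
  have h1 : f0 x₀ y₀ 1 = 1 := by rw [f0_of_ge hA hA.2.1.le]; ring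
  have := strictMono_f0 hA hx.1
  have := strictMono_f0 hA hx.2
  constructor <;> linarith

lemma f1_mem (hA : A1 x₀ y₀) {x : ℝ} (hx : x ∈ Ioo (0 : ℝ) 1) : f1 x₀ y₀ x ∈ Ioo (0 : ℝ) 1 := by
  obtain ⟨h1, h2⟩ := f0_mem hA (x := 1 - x) ⟨by linarith [hx.2], by linarith [hx.1]⟩
  rw [f1]
  constructor <;> linarith

lemma fb_mem (hA : A1 x₀ y₀) (b : Bool) {x : ℝ} (hx : x ∈ Ioo (0 : ℝ) 1) :
    fb x₀ y₀ b x ∈ Ioo (0 : ℝ) 1 := by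
  cases b
  · exact f0_mem hA hx
  · exact f1_mem hA hx

lemma monotone_f1 (hA : A1 x₀ y₀) : Monotone (f1 x₀ y₀) := fun x y h => by
  have := (strictMono_f0 hA).monotone (sub_le_sub_left h 1)
  rw [f1, f1]
  linarith

lemma continuous_fb (hA : A1 x₀ y₀) (b : Bool) : Continuous (fb x₀ y₀ b) := by
  cases b
  · exact continuous_f0 hA
  · exact continuous_const.sub ((continuous_f0 hA).comp (continuous_const.sub continuous_id))

/-- On the left branch, `f0` contracts the coordinate by any factor `l` for which the ratio of
distances to the boundary is controlled. -/
lemma coord_f0_sub_le (hA : A1 x₀ y₀) {l s t : ℝ} (hs : 0 < s) (hst : s ≤ t) (ht : t ≤ x₀)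
    (hl : ∀ x ∈ Icc s t, y₀ / x₀ * min x (1 - x) ≤ l * min (y₀ / x₀ * x) (1 - y₀ / x₀ * x)) :
    coord (f0 x₀ y₀ t) - coord (f0 x₀ y₀ s) ≤ l * (coord t - coord s) := by
  obtain ⟨h1, h2, h3⟩ := hA.slope
  rw [f0_of_le ht, f0_of_le (hst.trans ht)]
  have hmem : ∀ x ∈ Icc s t, y₀ / x₀ * x ∈ Ioo (0 : ℝ) 1 := fun x hx => by
    have := f0_mem hA (x := x) ⟨hs.trans_le hx.1, (hx.2.trans ht).trans_lt hA.2.1⟩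
    rwa [f0_of_le (hx.2.trans ht)] at this
  refine sub_le_coord_sub (g := fun x => coord (y₀ / x₀ * x))
    (g' := fun x => 1 / min (y₀ / x₀ * x) (1 - y₀ / x₀ * x) * (y₀ / x₀)) hs
    (ht.trans_lt hA.2.1) hst (fun x hx => ?_) fun x hx => ?_
  · refine (hasDerivAt_coord (hmem x hx)).comp x ?_
    simpa using (hasDerivAt_id x).const_mul (y₀ / x₀)
  · have hm : 0 < min (y₀ / x₀ * x) (1 - y₀ / x₀ * x) :=
      lt_min (hmem x hx).1 (by linarith [(hmem x hx).2])
    rw [mul_assoc, one_div_mul_eq_div, div_le_iff₀ hm]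
    exact hl x hx

lemma coord_f0_of_ge (hA : A1 x₀ y₀) {x : ℝ} (hx : x₀ ≤ x) (hx1 : x < 1) :
    coord (f0 x₀ y₀ x) = coord x - Real.log ((1 - y₀) / (1 - x₀)) := by
  obtain ⟨h1, h2⟩ := hA.slope'
  have h3 : 1 / 2 ≤ f0 x₀ y₀ x := by
    have := (strictMono_f0 hA).monotone hx
    rw [f0_of_le le_rfl, hA.slope.2.2] at this
    exact hA.2.2.1.trans this
  rw [coord_of_ge h3, coord_of_ge (hA.1.le.trans hx), f0_of_ge hA hx, sub_sub_cancel,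
    mul_left_comm, Real.log_mul (by linarith) (by linarith)]
  ring

lemma coord_f0_of_le (hA : A1 x₀ y₀) {x : ℝ} (hx : 0 < x) (hx1 : x ≤ 1 / 2) :
    coord (f0 x₀ y₀ x) = coord x + Real.log (y₀ / x₀) := by
  obtain ⟨h1, h2, -⟩ := hA.slope
  have h3 : y₀ / x₀ * x ≤ x := mul_le_of_le_one_left hx.le h2.le
  rw [f0_of_le (hx1.trans hA.1.le), coord_of_le hx1, coord_of_le (h3.trans hx1), mul_left_comm,
    Real.log_mul h1.ne' (by linarith)]
  ring

lemma coord_f0_sub_le_sub (hA : A1 x₀ y₀) {x y : ℝ} (hx : 0 < x) (hxy : x ≤ y) (hy : y < 1) :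
    coord (f0 x₀ y₀ y) - coord (f0 x₀ y₀ x) ≤ coord y - coord x := by
  obtain ⟨h1, h2, h3⟩ := hA.slope
  have key : ∀ {s t}, 0 < s → s ≤ t → t ≤ x₀ →
      coord (f0 x₀ y₀ t) - coord (f0 x₀ y₀ s) ≤ coord t - coord s := fun {s t} hs hst ht => by
    have := coord_f0_sub_le hA (l := 1) hs hst ht fun x _ => by
      rw [one_mul]
      refine le_min (mul_le_mul_of_nonneg_left (min_le_left _ _) h1.le) ?_
      have := mul_le_mul_of_nonneg_left (min_le_right x (1 - x)) h1.le
      linarith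
    linarith
  rcases le_total y x₀ with hy' | hy'
  · exact key hx hxy hy'
  rcases le_total x x₀ with hx' | hx'
  · have := key hx hx' le_rfl
    rw [coord_f0_of_ge hA le_rfl hA.2.1] at this
    rw [coord_f0_of_ge hA hy' hy]
    linarith
  · rw [coord_f0_of_ge hA hy' hy, coord_f0_of_ge hA hx' (hxy.trans_lt hy)]
    linarith

lemma coord_f0_le (hA : A1 x₀ y₀) {x : ℝ} (hx : x ∈ Ioo (0 : ℝ) 1) :
    coord (f0 x₀ y₀ x) ≤ coord x + Real.log (y₀ / x₀) := by
  rcases le_total x (1 / 2) with h | h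
  · exact (coord_f0_of_le hA hx.1 h).le
  · have := coord_f0_sub_le_sub hA (by norm_num) h hx.2
    rw [coord_f0_of_le hA (by norm_num) le_rfl] at this
    linarith

lemma le_coord_f0 (hA : A1 x₀ y₀) {x : ℝ} (hx : x ∈ Ioo (0 : ℝ) 1) :
    coord x - Real.log ((1 - y₀) / (1 - x₀)) ≤ coord (f0 x₀ y₀ x) := by
  rcases le_total x₀ x with h | h
  · exact (coord_f0_of_ge hA h hx.2).ge
  · have := coord_f0_sub_le_sub hA hx.1 h hA.2.1
    rw [coord_f0_of_ge hA le_rfl hA.2.1] at this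
    linarith

lemma coord_f1 (x : ℝ) : coord (f1 x₀ y₀ x) = -coord (f0 x₀ y₀ (1 - x)) := by
  rw [f1, coord_one_sub]

lemma abs_coord_f0_sub_le (hA : A1 x₀ y₀) {x y : ℝ} (hx : x ∈ Ioo (0 : ℝ) 1)
    (hy : y ∈ Ioo (0 : ℝ) 1) :
    |coord (f0 x₀ y₀ x) - coord (f0 x₀ y₀ y)| ≤ |coord x - coord y| := by
  wlog h : y ≤ x generalizing x y
  · rw [abs_sub_comm, abs_sub_comm (coord x)]
    exact this hy hx (le_of_not_ge h)
  have h1 := coord_le_coord hy.1 hx.2 h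
  have h2 := coord_le_coord (f0_mem hA hy).1 (f0_mem hA hx).2 ((strictMono_f0 hA).monotone h)
  rw [abs_of_nonneg (by linarith), abs_of_nonneg (by linarith)]
  exact coord_f0_sub_le_sub hA hy.1 h hx.2

lemma one_sub_mem {x : ℝ} (hx : x ∈ Ioo (0 : ℝ) 1) : 1 - x ∈ Ioo (0 : ℝ) 1 :=
  ⟨by linarith [hx.2], by linarith [hx.1]⟩

lemma abs_coord_fb_sub_le (hA : A1 x₀ y₀) (b : Bool) {x y : ℝ} (hx : x ∈ Ioo (0 : ℝ) 1)
    (hy : y ∈ Ioo (0 : ℝ) 1) :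
    |coord (fb x₀ y₀ b x) - coord (fb x₀ y₀ b y)| ≤ |coord x - coord y| := by
  cases b
  · exact abs_coord_f0_sub_le hA hx hy
  · have := abs_coord_f0_sub_le hA (one_sub_mem hx) (one_sub_mem hy)
    rw [coord_one_sub, coord_one_sub, neg_sub_neg, abs_sub_comm (coord y)] at this
    simp only [fb, if_true, coord_f1, neg_sub_neg]
    rwa [abs_sub_comm]

end Maps

section Words

variable {x₀ y₀ : ℝ}

lemma follow_fb_mem (hA : A1 x₀ y₀) (w : List Bool) {x : ℝ} (hx : x ∈ Ioo (0 : ℝ) 1) :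
    follow (fb x₀ y₀) w x ∈ Ioo (0 : ℝ) 1 := by
  induction w generalizing x with
  | nil => exact hx
  | cons b w ih => exact ih (fb_mem hA b hx)

lemma monotone_follow_fb (hA : A1 x₀ y₀) (w : List Bool) : Monotone (follow (fb x₀ y₀) w) := by
  induction w with
  | nil => exact monotone_id
  | cons b w ih =>
    refine ih.comp (?_ : Monotone (fb x₀ y₀ b))
    cases b
    · exact (strictMono_f0 hA).monotone
    · exact monotone_f1 hA

lemma abs_coord_follow_sub_le (hA : A1 x₀ y₀) (w : List Bool) {x y : ℝ} (hx : x ∈ Ioo (0 : ℝ) 1)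
    (hy : y ∈ Ioo (0 : ℝ) 1) :
    |coord (follow (fb x₀ y₀) w x) - coord (follow (fb x₀ y₀) w y)| ≤ |coord x - coord y| := by
  induction w generalizing x y with
  | nil => exact le_rfl
  | cons b w ih =>
    exact (ih (fb_mem hA b hx) (fb_mem hA b hy)).trans (abs_coord_fb_sub_le hA b hx hy)

lemma coord_iterate_f0_le (hA : A1 x₀ y₀) (n : ℕ) {x : ℝ} (hx : x ∈ Ioo (0 : ℝ) 1) :
    coord ((f0 x₀ y₀)^[n] x) ≤ coord x + n * Real.log (y₀ / x₀) := by
  induction n generalizing x with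
  | zero => simp
  | succ n ih =>
    have h1 := ih (f0_mem hA hx)
    have h2 := coord_f0_le hA hx
    rw [Function.iterate_succ_apply]
    push_cast
    linarith

lemma le_coord_iterate_f1 (hA : A1 x₀ y₀) (n : ℕ) {x : ℝ} (hx : x ∈ Ioo (0 : ℝ) 1) :
    coord x - n * Real.log (y₀ / x₀) ≤ coord ((f1 x₀ y₀)^[n] x) ∧
      coord ((f1 x₀ y₀)^[n] x) ≤ coord x + n * Real.log ((1 - y₀) / (1 - x₀)) := by
  induction n generalizing x with
  | zero => simp
  | succ n ih =>
    have h1 := ih (f1_mem hA hx)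
    have h2 := coord_f0_le hA (one_sub_mem hx)
    have h3 := le_coord_f0 hA (one_sub_mem hx)
    rw [coord_one_sub] at h2 h3
    rw [coord_f1] at h1
    rw [Function.iterate_succ_apply]
    push_cast
    constructor <;> linarith

/-- Every point is driven into the fundamental interval `[a₀ b, b]` of `f0`. -/
lemma exists_follow_mem_Icc (hA : A1 x₀ y₀) {b : ℝ} (hb : b ∈ Ioo (0 : ℝ) 1) (hb' : b ≤ x₀)
    (R : ℝ) : ∃ N, ∀ v ∈ Ioo (0 : ℝ) 1, |coord v| ≤ R →
      ∃ w : List Bool, w.length ≤ N ∧ follow (fb x₀ y₀) w v ∈ Icc (y₀ / x₀ * b) b := by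
  classical
  obtain ⟨h1, h2, -⟩ := hA.slope
  set s := -Real.log (y₀ / x₀) with hs
  have hs0 : 0 < s := neg_pos.2 (Real.log_neg h1 h2)
  set S := Real.log ((1 - y₀) / (1 - x₀)) with hS
  obtain ⟨n₁, hn₁⟩ := exists_nat_ge ((R + coord b) / s)
  obtain ⟨n₂, hn₂⟩ := exists_nat_ge ((R + n₁ * S - coord b) / s)
  rw [div_le_iff₀ hs0] at hn₁ hn₂
  refine ⟨n₁ + n₂, fun v hv hvR => ?_⟩
  obtain ⟨hR1, hR2⟩ := abs_le.1 hvR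
  set v₁ := (f1 x₀ y₀)^[n₁] v with hv₁
  have hv₁m : v₁ ∈ Ioo (0 : ℝ) 1 := by
    have := follow_fb_mem hA (List.replicate n₁ true) hv
    rwa [follow_replicate] at this
  obtain ⟨h3, h4⟩ := le_coord_iterate_f1 hA n₁ hv
  have hbv : b ≤ v₁ := le_of_coord_le hb.2 hv₁m.1 (by simp only [← hv₁] at *; linarith)
  have hm : ∀ n, (f0 x₀ y₀)^[n] v₁ ∈ Ioo (0 : ℝ) 1 := fun n => by
    have := follow_fb_mem hA (List.replicate n false) hv₁m
    rwa [follow_replicate] at this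
  have hn : (f0 x₀ y₀)^[n₂] v₁ ≤ b := by
    refine le_of_coord_le (hm n₂).2 hb.1 ?_
    have := coord_iterate_f0_le hA n₂ hv₁m
    simp only [← hv₁] at *
    linarith
  have hex : ∃ n, (f0 x₀ y₀)^[n] v₁ ≤ b := ⟨n₂, hn⟩
  have hle : Nat.find hex ≤ n₂ := Nat.find_min' hex hn
  refine ⟨List.replicate n₁ true ++ List.replicate (Nat.find hex) false, by simpa using hle, ?_⟩
  rw [follow_append, follow_replicate, follow_replicate]
  refine ⟨?_, Nat.find_spec hex⟩
  change y₀ / x₀ * b ≤ (f0 x₀ y₀)^[Nat.find hex] v₁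
  rcases hk : Nat.find hex with _ | k
  · exact (mul_le_of_le_one_left hb.1.le h2.le).trans hbv
  · have := Nat.find_min hex (m := k) (by omega)
    rw [Function.iterate_succ_apply', ← f0_of_le hb']
    exact (strictMono_f0 hA).monotone (not_le.1 this).le

/-- The map `f1` strictly contracts the coordinate distance to a point of `[a₀ b, b]`. -/
lemma exists_coord_f1_sub_le (hA : A1 x₀ y₀) {b : ℝ} (hb : b < 1 / 2)
    (hb' : 1 - x₀ < y₀ / x₀ * b) : ∃ l η : ℝ, 0 ≤ l ∧ l < 1 ∧ 0 < η ∧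
      ∀ u v, 0 < u → u ≤ v → v ∈ Icc (y₀ / x₀ * b) b →
        coord (f1 x₀ y₀ v) - coord (f1 x₀ y₀ u) ≤
          max (l * (coord v - coord u)) (coord v - coord u - (1 - l) * η) := by
  obtain ⟨h1, h2, h3⟩ := hA.slope
  have ⟨hx1, hx2, _, _⟩ := hA
  have hb0 : 0 < b := by
    by_contra! h
    nlinarith
  set a := y₀ / x₀
  have hab : 0 < 1 - a + a * b := by nlinarith
  set l := max (b / (1 - b)) (a * b / (1 - a + a * b)) with hl
  have hl1 : b ≤ l * (1 - b) := (div_le_iff₀ (by linarith)).1 (le_max_left _ _)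
  have hl2 : a * b ≤ l * (1 - a + a * b) := (div_le_iff₀ hab).1 (le_max_right _ _)
  have hl0 : 0 ≤ l := le_max_of_le_left (div_nonneg hb0.le (by linarith))
  have hlt : l < 1 := max_lt ((div_lt_one (by linarith)).2 (by linarith))
    ((div_lt_one hab).2 (by linarith))
  clear_value l
  have hab1 : a * b < 1 := by nlinarith
  have hη : 0 < coord (a * b) - coord (1 - x₀) :=
    (sub_pos.2 hb').trans_le (sub_le_coord_sub_coord (by linarith) hab1 hb'.le)
  refine ⟨l, coord (a * b) - coord (1 - x₀), hl0, hlt, hη, fun u v hu huv hv => ?_⟩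
  have hv1 : v < 1 := by linarith [hv.2]
  have key : ∀ u, 1 - x₀ ≤ u → u ≤ v →
      coord (f1 x₀ y₀ v) - coord (f1 x₀ y₀ u) ≤ l * (coord v - coord u) := by
    intro u hxu huv
    have := coord_f0_sub_le hA (l := l) (s := 1 - v) (t := 1 - u) (by linarith) (by linarith)
      (by linarith) (fun x hx => by
        have hxb : 1 - x ≤ b := by linarith [hx.1, hv.2]
        have hx0 : 0 ≤ 1 - x := by linarith [hx.2]
        refine (mul_le_mul_of_nonneg_left (min_le_right _ _) h1.le).trans ?_
        change a * (1 - x) ≤ l * min (a * x) (1 - a * x)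
        rw [mul_min_of_nonneg _ _ hl0]
        refine le_min ?_ ?_
        · have : 1 - x ≤ l * x := by nlinarith
          nlinarith
        · have : 0 ≤ (1 - l) * (a * (b - (1 - x))) :=
            mul_nonneg (by linarith) (mul_nonneg h1.le (by linarith))
          nlinarith)
    rw [coord_one_sub, coord_one_sub] at this
    rw [coord_f1, coord_f1]
    linarith
  rcases le_total (1 - x₀) u with hxu | hxu
  · exact le_max_of_le_left (key u hxu huv)
  · refine le_max_of_le_right ?_
    have h4 := key (1 - x₀) le_rfl (hb'.le.trans hv.1)
    have h5 := coord_f0_sub_le_sub hA (x := x₀) (y := 1 - u) (by linarith) (by linarith)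
      (by linarith)
    have h6 : coord x₀ = -coord (1 - x₀) := by rw [coord_one_sub, neg_neg]
    rw [coord_f1, coord_f1, sub_sub_cancel] at h4
    rw [coord_one_sub, h6] at h5
    rw [coord_f1, coord_f1]
    have h7 := coord_le_coord (mul_pos h1 hb0) hv1 hv.1
    nlinarith

/-- Along a word of bounded length the coordinate distance is contracted, uniformly on compact
sets. -/
lemma exists_follow_contraction (hA : A1 x₀ y₀) (R D : ℝ) : ∃ (N : ℕ) (l : ℝ), l < 1 ∧
    ∀ x ∈ Ioo (0 : ℝ) 1, ∀ y ∈ Ioo (0 : ℝ) 1, |coord x| ≤ R → |coord x - coord y| ≤ D →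
      ∃ w : List Bool, w.length ≤ N ∧
        |coord (follow (fb x₀ y₀) w x) - coord (follow (fb x₀ y₀) w y)| ≤
          l * |coord x - coord y| := by
  obtain ⟨h1, h2, h3⟩ := hA.slope
  obtain ⟨b, hb1, hb2⟩ : ∃ b, (1 - x₀) / (y₀ / x₀) < b ∧ b < 1 / 2 := by
    refine exists_between ?_
    obtain ⟨hx1, hx2, hy1, hy2⟩ := hA
    rw [div_lt_iff₀ h1, div_mul_div_comm, one_mul, lt_div_iff₀ (by linarith)]
    nlinarith [mul_pos (sub_pos.2 hx1) (sub_pos.2 hx1)]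
  rw [div_lt_iff₀' h1] at hb1
  have hb0 : 0 < b := by
    by_contra! h
    nlinarith [hA.2.1]
  obtain ⟨l, η, hl0, hl1, hη, hl⟩ := exists_coord_f1_sub_le hA hb2 hb1
  obtain ⟨N, hN⟩ := exists_follow_mem_Icc hA ⟨hb0, by linarith⟩ (by linarith [hA.1]) (R + |D|)
  set D' := max D 1
  have hD' : 0 < D' := lt_max_of_lt_right one_pos
  set l' := max l (1 - (1 - l) * η / D') with hl'
  have hl'0 : 0 ≤ l' := hl0.trans (le_max_left _ _)
  have key : ∀ u ∈ Ioo (0 : ℝ) 1, ∀ v ∈ Ioo (0 : ℝ) 1, u ≤ v → |coord v| ≤ R + |D| →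
      |coord v - coord u| ≤ D → ∃ w : List Bool, w.length ≤ N + 1 ∧
        |coord (follow (fb x₀ y₀) w v) - coord (follow (fb x₀ y₀) w u)| ≤
          l' * |coord v - coord u| := by
    intro u hu v hv huv hvR hD
    obtain ⟨w, hwN, hw⟩ := hN v hv hvR
    refine ⟨w ++ [true], by simpa using hwN, ?_⟩
    have h4 := abs_coord_follow_sub_le hA w hv hu
    have h5 := monotone_follow_fb hA w huv
    have hu' := follow_fb_mem hA w hu
    have hv' := follow_fb_mem hA w hv
    rw [follow_append, follow_append]
    set u' := follow (fb x₀ y₀) w u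
    set v' := follow (fb x₀ y₀) w v
    change |coord (f1 x₀ y₀ v') - coord (f1 x₀ y₀ u')| ≤ _
    refine le_trans ?_ (mul_le_mul_of_nonneg_left h4 hl'0)
    have h6 := coord_le_coord hu'.1 hv'.2 h5
    have h7 := coord_le_coord (f1_mem hA hu').1 (f1_mem hA hv').2 (monotone_f1 hA h5)
    rw [abs_of_nonneg (sub_nonneg.2 h7)]
    have h8 := (h4.trans hD).trans (le_max_left D 1)
    rw [abs_of_nonneg (sub_nonneg.2 h6)] at h8 ⊢
    refine (hl u' v' hu'.1 h5 hw).trans (max_le ?_ ?_)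
    · exact mul_le_mul_of_nonneg_right (le_max_left _ _) (sub_nonneg.2 h6)
    · refine le_trans ?_ (mul_le_mul_of_nonneg_right (le_max_right _ _) (sub_nonneg.2 h6))
      have h9 : (1 - l) * η / D' * (coord v' - coord u') ≤ (1 - l) * η := by
        rw [div_mul_eq_mul_div, div_le_iff₀ hD']
        exact mul_le_mul_of_nonneg_left h8 (mul_nonneg (by linarith) hη.le)
      linarith
  refine ⟨N + 1, l', max_lt hl1 ?_, fun x hx y hy hxR hD => ?_⟩
  · have : 0 < (1 - l) * η / D' := div_pos (mul_pos (by linarith) hη) hD'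
    linarith
  · rcases le_total y x with h | h
    · exact key y hy x hx h (hxR.trans (by linarith [abs_nonneg D])) hD
    · have h4 : |coord y| ≤ R + |D| := by
        have := abs_sub_abs_le_abs_sub (coord y) (coord x)
        rw [abs_sub_comm] at this
        linarith [le_abs_self D]
      rw [abs_sub_comm] at hD
      obtain ⟨w, hw, hwl⟩ := key x hx y hy h h4 hD
      refine ⟨w, hw, ?_⟩
      rwa [abs_sub_comm, abs_sub_comm (coord x)]

end Words

section Lyapunov

variable {x₀ y₀ : ℝ}

lemma eventually_mean_exp_lt_one {c₀ c₁ a b : ℝ} (hc : c₀ + c₁ = 1) (h : 0 < c₀ * a + c₁ * b) :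
    ∀ᶠ α in 𝓝[>] (0 : ℝ), c₀ * Real.exp (-α * a) + c₁ * Real.exp (-α * b) < 1 := by
  have hd : ∀ a : ℝ, HasDerivAt (fun α : ℝ => Real.exp (-α * a)) (-a) 0 := fun a => by
    simpa using ((hasDerivAt_id' (0 : ℝ)).neg.mul_const a).exp
  have h1 := ((hd a).const_mul c₀).add ((hd b).const_mul c₁)
  have h2 := (hasDerivAt_iff_tendsto_slope_zero.1 h1).mono_left
    (nhdsWithin_mono _ fun x (hx : 0 < x) => hx.ne')
  filter_upwards [h2.eventually (gt_mem_nhds (show c₀ * -a + c₁ * -b < 0 by linarith)),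
    self_mem_nhdsWithin] with α h3 h4
  have h4 : 0 < α := h4
  simp only [zero_add, Pi.add_apply, neg_zero, zero_mul, Real.exp_zero, mul_one, hc,
    smul_eq_mul] at h3
  by_contra! h5
  exact absurd h3 (not_lt.2 (mul_nonneg (inv_nonneg.2 h4.le) (by linarith)))

/-- A power of the distance to the endpoint `0` contracts in mean, up to a constant, when the
average Lyapunov exponent at `0` is positive. -/
lemma exists_mean_exp_le (hA : A1 x₀ y₀) {q₀ q₁ : ℝ → ℝ} (h₀ : Continuous q₀) (h₁ : Continuous q₁)
    (hq : ∀ x, q₀ x + q₁ x = 1) (hq₀ : ∀ x, 0 ≤ q₀ x) (hq₁ : ∀ x, 0 ≤ q₁ x) {α : ℝ} (hα : 0 < α)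
    (h : q₀ 0 * Real.exp (-α * Real.log (y₀ / x₀)) +
      q₁ 0 * Real.exp (-α * Real.log ((1 - y₀) / (1 - x₀))) < 1) :
    ∃ γ C : ℝ, 0 ≤ γ ∧ γ < 1 ∧ 0 ≤ C ∧ ∀ x ∈ Ioo (0 : ℝ) 1,
      q₀ x * Real.exp (-α * Real.log (f0 x₀ y₀ x)) + q₁ x * Real.exp (-α * Real.log (f1 x₀ y₀ x)) ≤
        γ * Real.exp (-α * Real.log x) + C := by
  obtain ⟨ha, ha1, -⟩ := hA.slope
  obtain ⟨hb, -⟩ := hA.slope'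
  have ⟨hx1, hx2, _, _⟩ := hA
  obtain ⟨γ, hγ, hγ1⟩ := exists_between h
  have hc : Continuous fun x => q₀ x * Real.exp (-α * Real.log (y₀ / x₀)) +
      q₁ x * Real.exp (-α * Real.log ((1 - y₀) / (1 - x₀))) := by fun_prop
  obtain ⟨η, hη, hηγ⟩ := Metric.eventually_nhds_iff.1 (hc.continuousAt.eventually (gt_mem_nhds hγ))
  set ζ := min (η / 2) (1 - x₀) with hζ
  have hζ0 : 0 < ζ := lt_min (by linarith) (by linarith)
  have hf0 : ∀ x, x ≤ ζ → f0 x₀ y₀ x = y₀ / x₀ * x := fun x hx =>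
    f0_of_le (by linarith [min_le_right (η / 2) (1 - x₀)])
  have hf1 : ∀ x, x ≤ ζ → f1 x₀ y₀ x = (1 - y₀) / (1 - x₀) * x := fun x hx => by
    rw [f1, f0_of_ge hA (by linarith [min_le_right (η / 2) (1 - x₀)])]
    ring
  have hanti : ∀ x y : ℝ, 0 < x → x ≤ y →
      Real.exp (-α * Real.log y) ≤ Real.exp (-α * Real.log x) := fun x y hx hxy => by
    have := mul_le_mul_of_nonneg_left (Real.log_le_log hx hxy) hα.le
    exact Real.exp_le_exp.2 (by linarith)
  refine ⟨γ, Real.exp (-α * Real.log (y₀ / x₀ * ζ)), ?_, hγ1, (Real.exp_pos _).le, fun x hx => ?_⟩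
  · refine le_trans ?_ hγ.le
    have := hq₀ 0
    have := hq₁ 0
    positivity
  rcases le_total x ζ with hxζ | hxζ
  · have h3 : dist x 0 < η := by
      rw [Real.dist_0_eq_abs, abs_of_pos hx.1]
      linarith [min_le_left (η / 2) (1 - x₀)]
    rw [hf0 x hxζ, hf1 x hxζ, Real.log_mul ha.ne' hx.1.ne', Real.log_mul (by linarith) hx.1.ne',
      mul_add, mul_add, Real.exp_add, Real.exp_add]
    have := mul_le_mul_of_nonneg_right (hηγ h3).le (Real.exp_pos (-α * Real.log x)).le
    linarith [Real.exp_pos (-α * Real.log (y₀ / x₀ * ζ))]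
  · have h3 : y₀ / x₀ * ζ ≤ f0 x₀ y₀ x := by
      rw [← hf0 ζ le_rfl]
      exact (strictMono_f0 hA).monotone hxζ
    have h4 : y₀ / x₀ * ζ ≤ f1 x₀ y₀ x := by
      refine le_trans ?_ (monotone_f1 hA hxζ)
      rw [hf1 ζ le_rfl]
      exact mul_le_mul_of_nonneg_right (by linarith) hζ0.le
    have h5 := mul_le_mul_of_nonneg_left (hanti _ _ (mul_pos ha hζ0) h3) (hq₀ x)
    have h6 := mul_le_mul_of_nonneg_left (hanti _ _ (mul_pos ha hζ0) h4) (hq₁ x)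
    rw [← one_mul (Real.exp (-α * Real.log (y₀ / x₀ * ζ))), ← hq x]
    have : 0 ≤ γ * Real.exp (-α * Real.log x) := by
      refine mul_nonneg (le_trans ?_ hγ.le) (Real.exp_pos _).le
      have := hq₀ 0
      have := hq₁ 0
      positivity
    linarith

/-- The weights, extended continuously to the real line. -/
noncomputable def weight (p₀ p₁ : ℝ → ℝ) (b : Bool) (x : ℝ) : ℝ :=
  (if b then p₁ else p₀) (projIcc 0 1 zero_le_one x)

variable {p₀ p₁ : ℝ → ℝ}

lemma weight_of_mem {x : ℝ} (hx : x ∈ Icc (0 : ℝ) 1) (b : Bool) :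
    weight p₀ p₁ b x = if b then p₁ x else p₀ x := by
  rw [weight, projIcc_of_mem _ hx]
  cases b <;> rfl

lemma continuous_weight (hA : A3 p₀ p₁) (b : Bool) : Continuous (weight p₀ p₁ b) := by
  have : ContinuousOn (if b then p₁ else p₀) (Icc 0 1) := by
    cases b
    · exact hA.1
    · exact hA.2.1
  exact this.comp_continuous (continuous_subtype_val.comp continuous_projIcc)
    fun x => (projIcc 0 1 zero_le_one x).2

lemma exists_isWeight (hA : A3 p₀ p₁) : ∃ δ, IsWeight (weight p₀ p₁) δ := by
  obtain ⟨u, hu, hu'⟩ := isCompact_Icc.exists_isMinOn (nonempty_Icc.2 zero_le_one) hA.1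
  obtain ⟨v, hv, hv'⟩ := isCompact_Icc.exists_isMinOn (nonempty_Icc.2 zero_le_one) hA.2.1
  refine ⟨min (p₀ u) (p₁ v), lt_min (hA.2.2 u hu).2.1 (hA.2.2 v hv).2.2.2.1, fun b x => ?_,
    fun x => ?_⟩
  · cases b
    · exact (min_le_left _ _).trans (hu' (projIcc 0 1 zero_le_one x).2)
    · exact (min_le_right _ _).trans (hv' (projIcc 0 1 zero_le_one x).2)
  · have := (hA.2.2 _ (projIcc 0 1 zero_le_one x).2).1
    rw [Fintype.sum_bool, add_comm]
    exact this

lemma exists_lyapunov (hA : A1 x₀ y₀) (hA3 : A3 p₀ p₁) (hA4 : A4 x₀ y₀ p₀ p₁) :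
    ∃ (V : ℝ → ℝ) (γ C : ℝ), 0 ≤ γ ∧ γ < 1 ∧ 0 ≤ C ∧ (∀ x, 0 ≤ V x) ∧
      (∀ x ∈ Ioo (0 : ℝ) 1, avg (weight p₀ p₁) (fb x₀ y₀) V x ≤ γ * V x + C) ∧
      ∀ R, ∃ ε > 0, ∀ x ∈ Ioo (0 : ℝ) 1, V x ≤ R → x ∈ Icc ε (1 - ε) := by
  obtain ⟨δ, hw⟩ := exists_isWeight hA3
  have h0 : (0 : ℝ) ∈ Icc (0 : ℝ) 1 := ⟨le_rfl, zero_le_one⟩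
  have h1 : (1 : ℝ) ∈ Icc (0 : ℝ) 1 := ⟨zero_le_one, le_rfl⟩
  have hsum : ∀ x, weight p₀ p₁ false x + weight p₀ p₁ true x = 1 := fun x => by
    rw [← hw.sum x, Fintype.sum_bool, add_comm]
  have e1 := eventually_mean_exp_lt_one (hA3.2.2 0 h0).1 hA4.1
  have e2 := eventually_mean_exp_lt_one ((add_comm _ _).trans (hA3.2.2 1 h1).1)
    (hA4.2.trans_eq (add_comm _ _))
  obtain ⟨α, ⟨hα1, hα2⟩, hα⟩ := ((e1.and e2).and self_mem_nhdsWithin).exists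
  have hα : 0 < α := hα
  have hc := continuous_weight hA3
  obtain ⟨γ, C, hγ, hγ1, hC, hle⟩ := exists_mean_exp_le hA (hc false) (hc true) hsum
    (hw.nonneg _) (hw.nonneg _) hα (by simpa [weight_of_mem h0] using hα1)
  obtain ⟨γ', C', hγ', hγ1', hC', hle'⟩ := exists_mean_exp_le hA
    (q₀ := fun x => weight p₀ p₁ true (1 - x)) (q₁ := fun x => weight p₀ p₁ false (1 - x))
    ((hc true).comp (continuous_const.sub continuous_id))
    ((hc false).comp (continuous_const.sub continuous_id))
    (fun x => (add_comm _ _).trans (hsum (1 - x)))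
    (fun x => hw.nonneg _ _) (fun x => hw.nonneg _ _) hα (by simpa [weight_of_mem h1] using hα2)
  refine ⟨fun x => Real.exp (-α * Real.log x) + Real.exp (-α * Real.log (1 - x)), max γ γ', C + C',
    le_max_of_le_left hγ, max_lt hγ1 hγ1', by positivity, fun x => by positivity, fun x hx => ?_,
    fun R => ⟨Real.exp (-(R / α)), Real.exp_pos _, fun x hx hV => ?_⟩⟩
  · have h2 := hle x hx
    have h3 := hle' (1 - x) (one_sub_mem hx)
    rw [f1_one_sub, sub_sub_cancel] at h3
    have h4 : f0 x₀ y₀ (1 - x) = 1 - f1 x₀ y₀ x := by rw [f1, sub_sub_cancel]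
    rw [h4] at h3
    have h5 := mul_le_mul_of_nonneg_right (le_max_left γ γ') (Real.exp_pos (-α * Real.log x)).le
    have h6 := mul_le_mul_of_nonneg_right (le_max_right γ γ')
      (Real.exp_pos (-α * Real.log (1 - x))).le
    simp only [avg, Fintype.sum_bool, fb, if_true, Bool.false_eq_true, if_false]
    linarith
  · have key : ∀ y : ℝ, 0 < y → Real.exp (-α * Real.log y) ≤ R → Real.exp (-(R / α)) ≤ y := by
      intro y hy h
      rw [← Real.le_log_iff_exp_le hy, neg_le, le_div_iff₀ hα]
      linarith [Real.add_one_le_exp (-α * Real.log y)]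
    have h2 := key x hx.1 (by linarith [Real.exp_pos (-α * Real.log (1 - x))])
    have h3 := key (1 - x) (one_sub_mem hx).1 (by linarith [Real.exp_pos (-α * Real.log x)])
    exact ⟨h2, by linarith⟩

end Lyapunov

section Synchronization

variable {x₀ y₀ : ℝ} {p₀ p₁ : ℝ → ℝ}

lemma abs_sub_le_add_mul_of_uniformContinuous {φ : ℝ → ℝ} {M : ℝ} (hφ : UniformContinuous φ)
    (hM : ∀ x, |φ x| ≤ M) {ω : ℝ} (hω : 0 < ω) :
    ∃ L, 0 ≤ L ∧ ∀ x y, |φ x - φ y| ≤ ω + L * |x - y| := by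
  have hM0 : 0 ≤ M := (abs_nonneg _).trans (hM 0)
  obtain ⟨δ, hδ, h⟩ := Metric.uniformContinuous_iff.1 hφ ω hω
  refine ⟨2 * M / δ, by positivity, fun x y => ?_⟩
  rcases lt_or_ge |x - y| δ with hxy | hxy
  · have := (h (a := x) (b := y) hxy).le
    rw [Real.dist_eq] at this
    exact this.trans (le_add_of_nonneg_right (by positivity))
  · have h1 : 2 * M ≤ 2 * M / δ * |x - y| := by
      rw [div_mul_eq_mul_div, le_div_iff₀ hδ]
      exact mul_le_mul_of_nonneg_left hxy (by linarith)
    linarith [abs_sub (φ x) (φ y), hM x, hM y]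

/-- The iterated averages of a bounded uniformly continuous function forget the initial point. -/
lemma tendsto_iterate_avg_fb_sub (hA1 : A1 x₀ y₀) (hA2 : A2 p₀ p₁) (hA3 : A3 p₀ p₁)
    (hA4 : A4 x₀ y₀ p₀ p₁) {φ : ℝ → ℝ} {M : ℝ} (hφ : UniformContinuous φ) (hM : ∀ x, |φ x| ≤ M)
    {x y : ℝ} (hx : x ∈ Ioo (0 : ℝ) 1) (hy : y ∈ Ioo (0 : ℝ) 1) :
    Tendsto (fun n => (avg (weight p₀ p₁) (fb x₀ y₀))^[n] φ x -
      (avg (weight p₀ p₁) (fb x₀ y₀))^[n] φ y) atTop (𝓝 0) := by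
  obtain ⟨δ, hw⟩ := exists_isWeight hA3
  obtain ⟨V, γ, C, hγ, hγ1, hC, hV0, hV, hVR⟩ := exists_lyapunov hA1 hA3 hA4
  obtain ⟨β, hβ, hβs⟩ := hA2
  have hβ0 : ∀ t, 0 < t → 0 ≤ β t := fun t ht => (abs_nonneg _).trans
    (hβ t 0 ⟨le_rfl, zero_le_one⟩ 0 ⟨le_rfl, zero_le_one⟩ (by simpa using ht.le)).1
  let f' : Bool → Ioo (0 : ℝ) 1 → Ioo (0 : ℝ) 1 := fun b x => ⟨fb x₀ y₀ b x, fb_mem hA1 b x.2⟩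
  let p' : Bool → Ioo (0 : ℝ) 1 → ℝ := fun b x => weight p₀ p₁ b x
  have hw' : IsWeight p' δ := ⟨hw.pos, fun b x => hw.le b x, fun x => hw.sum x⟩
  have hfol : ∀ w (x : Ioo (0 : ℝ) 1),
      ((follow f' w x : Ioo (0 : ℝ) 1) : ℝ) = follow (fb x₀ y₀) w x := fun w x => by
    simpa using follow_semiconj (f := f') (f' := fb x₀ y₀) Subtype.val id (fun b x => rfl) w x
  have hiter : ∀ n (x : Ioo (0 : ℝ) 1), (avg p' f')^[n] (fun z => φ z) x =
      (avg (weight p₀ p₁) (fb x₀ y₀))^[n] φ x := by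
    intro n
    induction n with
    | zero => exact fun x => rfl
    | succ n ih =>
      intro x
      simp only [Function.iterate_succ_apply']
      exact Finset.sum_congr rfl fun b _ => by rw [ih]
  have h := tendsto_iterate_avg_sub hw' (f := f') (h := fun x => coord x) (V := fun x => V x)
    (M := M) (β := β) (φ := fun x => φ x) hγ hγ1 hC (fun x => hV0 x) (fun x => hV x x.2)
    (fun b x y => abs_coord_fb_sub_le hA1 b x.2 y.2) ?_ ?_ ?_ ?_ ?_ (fun x => hM x) ?_
    ⟨x, hx⟩ ⟨y, hy⟩
  · simpa only [hiter] using h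
  · intro R D
    obtain ⟨ε, hε, hεV⟩ := hVR R
    obtain ⟨N, l, hl, hN⟩ := exists_follow_contraction hA1 (max |coord ε| |coord (1 - ε)|) D
    refine ⟨N, l, hl, fun x y hx hxy => ?_⟩
    obtain ⟨h1, h2⟩ := hεV x x.2 hx
    obtain ⟨w, hwN, hwl⟩ := hN x x.2 y y.2 (abs_le_max_abs_abs
      (coord_le_coord hε x.2.2 h1) (coord_le_coord x.2.1 (by linarith) h2)) hxy
    exact ⟨w, hwN, by simpa only [hfol] using hwl⟩
  · intro R
    obtain ⟨ε, hε, hεV⟩ := hVR R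
    refine ⟨max |coord ε| |coord (1 - ε)|, fun x hx => ?_⟩
    obtain ⟨h1, h2⟩ := hεV x x.2 hx
    exact abs_le_max_abs_abs
      (coord_le_coord hε x.2.2 h1) (coord_le_coord x.2.1 (by linarith) h2)
  · intro τ hτ b x y
    have hβ0 := hβ0 τ hτ
    have h1 := abs_sub_le_abs_coord_sub x.2 y.2
    rcases le_total |coord x - coord y| τ with h | h
    · refine le_trans ?_ (le_add_of_nonneg_right (by positivity))
      have h2 := hβ τ x (Ioo_subset_Icc_self x.2) y (Ioo_subset_Icc_self y.2) (h1.trans h)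
      simp only [p', weight_of_mem (Ioo_subset_Icc_self x.2),
        weight_of_mem (Ioo_subset_Icc_self y.2)]
      cases b
      · exact h2.1
      · exact h2.2
    · refine le_trans ?_ (le_add_of_nonneg_left hβ0)
      refine le_trans ?_ ((one_le_div hτ).2 h)
      have := hw'.nonneg b x
      have := hw'.nonneg b y
      have := hw'.le_one b x
      have := hw'.le_one b y
      rw [abs_le]
      constructor <;> linarith
  · exact hβ0
  · exact fun t ht ht1 => by simpa using hβs 1 zero_le_one t ht ht1
  · intro ω hω
    obtain ⟨L, hL, hφL⟩ := abs_sub_le_add_mul_of_uniformContinuous hφ hM hω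
    refine ⟨L, hL, fun x y => (hφL x y).trans ?_⟩
    have := mul_le_mul_of_nonneg_left (abs_sub_le_abs_coord_sub x.2 y.2) hL
    linarith

end Synchronization

section Push

variable {ι Z : Type*} [Fintype ι] {p : ι → Z → ℝ} {f : ι → Z → Z} {δ : ℝ}

/-- A drift condition on an invariant set bounds the iterated averages there. -/
lemma iterate_avg_le_of_lyapunov_on (hp : IsWeight p δ) {S : Set Z} (hfS : ∀ i, MapsTo (f i) S S)
    {V ψ : Z → ℝ} {γ C a b : ℝ} (hγ : 0 ≤ γ) (hγ1 : γ < 1) (hC : 0 ≤ C) (hb : 0 ≤ b)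
    (hV : ∀ z ∈ S, avg p f V z ≤ γ * V z + C) (hψ : ∀ z ∈ S, ψ z ≤ a + b * V z) (n : ℕ) {z : Z}
    (hz : z ∈ S) :
    (avg p f)^[n] ψ z ≤ a + b * (γ ^ n * V z + C / (1 - γ)) := by
  have h1 : 0 < 1 - γ := by linarith
  induction n generalizing ψ a b with
  | zero =>
    have : 0 ≤ b * (C / (1 - γ)) := by positivity
    have := hψ z hz
    simp only [Function.iterate_zero, id_eq, pow_zero, one_mul]
    linarith
  | succ n ih =>
    rw [Function.iterate_succ_apply]
    refine (ih (a := a + b * C) (b := b * γ) (by positivity) fun y hy => ?_).trans_eq ?_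
    · have h2 := avg_le_avg hp (f := f) (ψ := ψ) (χ := fun z => a + b * V z) (z := y)
        fun i => hψ _ (hfS i hy)
      rw [avg_affine hp] at h2
      have := mul_le_mul_of_nonneg_left (hV y hy) hb
      linarith
    · field_simp
      ring

variable [MeasurableSpace Z]

/-- The law after one step of the random map choosing `f i` with probability `p i z`, started
from the law `μ`. -/
noncomputable def push (p : ι → Z → ℝ) (f : ι → Z → Z) (μ : Measure Z) : Measure Z :=
  ∑ i, (μ.withDensity fun z => ENNReal.ofReal (p i z)).map (f i)

lemma push_apply (hf : ∀ i, Measurable (f i)) (μ : Measure Z) {A : Set Z}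
    (hA : MeasurableSet A) :
    push p f μ A = ∑ i, ∫⁻ z in f i ⁻¹' A, ENNReal.ofReal (p i z) ∂μ := by
  rw [push, Measure.finsetSum_apply]
  refine Finset.sum_congr rfl fun i _ => ?_
  rw [Measure.map_apply (hf i) hA, withDensity_apply _ (hf i hA)]

lemma isProbabilityMeasure_push (hp : IsWeight p δ) (hpm : ∀ i, Measurable (p i))
    (hf : ∀ i, Measurable (f i)) (μ : Measure Z) [IsProbabilityMeasure μ] :
    IsProbabilityMeasure (push p f μ) := by
  constructor
  rw [push_apply hf μ MeasurableSet.univ]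
  simp only [preimage_univ, Measure.restrict_univ]
  rw [← lintegral_finsetSum _ fun i _ => (hpm i).ennreal_ofReal]
  simp_rw [← ENNReal.ofReal_sum_of_nonneg fun i _ => hp.nonneg i _, hp.sum]
  simp

lemma isProbabilityMeasure_iterate_push (hp : IsWeight p δ) (hpm : ∀ i, Measurable (p i))
    (hf : ∀ i, Measurable (f i)) (μ : Measure Z) [IsProbabilityMeasure μ] (n : ℕ) :
    IsProbabilityMeasure ((push p f)^[n] μ) := by
  induction n with
  | zero => assumption
  | succ n ih =>
    rw [Function.iterate_succ_apply']
    exact isProbabilityMeasure_push hp hpm hf _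

lemma measurable_avg (hpm : ∀ i, Measurable (p i)) (hf : ∀ i, Measurable (f i)) {ψ : Z → ℝ}
    (hψ : Measurable ψ) : Measurable (avg p f ψ) :=
  Finset.measurable_fun_sum _ fun i _ => (hpm i).mul (hψ.comp (hf i))

lemma measurable_iterate_avg (hpm : ∀ i, Measurable (p i)) (hf : ∀ i, Measurable (f i))
    {ψ : Z → ℝ} (hψ : Measurable ψ) (n : ℕ) : Measurable ((avg p f)^[n] ψ) := by
  induction n with
  | zero => exact hψ
  | succ n ih =>
    rw [Function.iterate_succ_apply']
    exact measurable_avg hpm hf ih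

lemma integral_push (hp : IsWeight p δ) (hpm : ∀ i, Measurable (p i))
    (hf : ∀ i, Measurable (f i)) (μ : Measure Z) [IsProbabilityMeasure μ] {ψ : Z → ℝ} {M : ℝ}
    (hψ : Measurable ψ) (hM : ∀ z, |ψ z| ≤ M) :
    ∫ z, ψ z ∂push p f μ = ∫ z, avg p f ψ z ∂μ := by
  have hprob := isProbabilityMeasure_push hp hpm hf μ
  have hintegral : ∀ ν : Measure Z, IsFiniteMeasure ν → Integrable ψ ν := fun ν _ =>
    Integrable.of_bound hψ.aestronglyMeasurable M (ae_of_all _ hM)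
  have hfin : ∀ i, IsFiniteMeasure ((μ.withDensity fun z => ENNReal.ofReal (p i z)).map (f i)) := by
    intro i
    refine isFiniteMeasure_of_le (push p f μ) ?_
    exact Finset.single_le_sum
      (f := fun i => (μ.withDensity fun z => ENNReal.ofReal (p i z)).map (f i))
      (fun j _ => Measure.zero_le _) (Finset.mem_univ i)
  rw [push, integral_finsetSum_measure fun i _ => hintegral _ (hfin i)]
  simp only [avg]
  rw [integral_finsetSum]
  · refine Finset.sum_congr rfl fun i _ => ?_
    rw [integral_map (hf i).aemeasurable hψ.aestronglyMeasurable,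
      integral_withDensity_eq_integral_toReal_smul (hpm i).ennreal_ofReal
        (ae_of_all _ fun z => ENNReal.ofReal_lt_top)]
    simp only [ENNReal.toReal_ofReal (hp.nonneg i _), smul_eq_mul]
  · intro i _
    refine Integrable.of_bound ((hpm i).mul (hψ.comp (hf i))).aestronglyMeasurable M
      (ae_of_all _ fun z => ?_)
    rw [Real.norm_eq_abs, abs_mul, abs_of_nonneg (hp.nonneg i z)]
    exact (mul_le_of_le_one_left (abs_nonneg _) (hp.le_one i z)).trans (hM _)

lemma integral_iterate_push (hp : IsWeight p δ) (hpm : ∀ i, Measurable (p i))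
    (hf : ∀ i, Measurable (f i)) (μ : Measure Z) [IsProbabilityMeasure μ] {ψ : Z → ℝ} {M : ℝ}
    (hψ : Measurable ψ) (hM : ∀ z, |ψ z| ≤ M) (n : ℕ) :
    ∫ z, ψ z ∂(push p f)^[n] μ = ∫ z, (avg p f)^[n] ψ z ∂μ := by
  induction n generalizing ψ with
  | zero => rfl
  | succ n ih =>
    have := isProbabilityMeasure_iterate_push hp hpm hf μ n
    rw [Function.iterate_succ_apply', integral_push hp hpm hf _ hψ hM,
      ih (measurable_avg hpm hf hψ) fun z => abs_iterate_avg_le hp hM 1 z,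
      Function.iterate_succ_apply]

lemma push_apply_eq_zero (hf : ∀ i, Measurable (f i)) {μ : Measure Z} {S : Set Z}
    (hS : MeasurableSet S) (hfS : ∀ i, MapsTo (f i) S S) (hμ : μ Sᶜ = 0) :
    push p f μ Sᶜ = 0 := by
  rw [push_apply hf μ hS.compl]
  refine Finset.sum_eq_zero fun i _ => ?_
  refine setLIntegral_measure_zero _ _ (measure_mono_null (fun z hz hzS => hz (hfS i hzS)) hμ)

end Push

section Stationary

variable {x₀ y₀ : ℝ} {p₀ p₁ : ℝ → ℝ}

lemma measurable_fb (hA : A1 x₀ y₀) (b : Bool) : Measurable (fb x₀ y₀ b) :=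
  (continuous_fb hA b).measurable

lemma measurable_weight (hA : A3 p₀ p₁) (b : Bool) : Measurable (weight p₀ p₁ b) :=
  (continuous_weight hA b).measurable

lemma measure_compl_Ioo {μ : Measure ℝ} [IsProbabilityMeasure μ] (h : μ (Ioo 0 1) = 1) :
    μ (Ioo (0 : ℝ) 1)ᶜ = 0 :=
  (prob_compl_eq_zero_iff measurableSet_Ioo).2 h

lemma ae_mem_Ioo {μ : Measure ℝ} [IsProbabilityMeasure μ] (h : μ (Ioo 0 1) = 1) :
    ∀ᵐ x ∂μ, x ∈ Ioo (0 : ℝ) 1 :=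
  measure_compl_Ioo h

lemma push_eq_Pop (hA : A1 x₀ y₀) {μ : Measure ℝ} [IsProbabilityMeasure μ]
    (h : μ (Ioo 0 1) = 1) {A : Set ℝ} (hAm : MeasurableSet A) :
    push (weight p₀ p₁) (fb x₀ y₀) μ A = Pop x₀ y₀ p₀ p₁ μ A := by
  rw [push_apply (measurable_fb hA) μ hAm, Fintype.sum_bool, add_comm, Pop]
  congr 1 <;>
  · refine lintegral_congr_ae (ae_restrict_of_ae ?_)
    filter_upwards [ae_mem_Ioo h] with x hx
    simp [weight_of_mem (Ioo_subset_Icc_self hx)]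

lemma stationary_iff (hA : A1 x₀ y₀) (hA3 : A3 p₀ p₁) (μ : Measure ℝ) :
    Stationary x₀ y₀ p₀ p₁ μ ↔
      IsProbabilityMeasure μ ∧ μ (Ioo 0 1) = 1 ∧ push (weight p₀ p₁) (fb x₀ y₀) μ = μ := by
  refine and_congr_right fun hμ => and_congr_right fun h => ⟨fun H => ?_, fun H A hA' _ => ?_⟩
  · obtain ⟨δ, hw⟩ := exists_isWeight hA3
    have hprob := isProbabilityMeasure_push hw (measurable_weight hA3) (measurable_fb hA) μ
    have h' := (push_eq_Pop (p₀ := p₀) (p₁ := p₁) hA h measurableSet_Ioo).trans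
      (H _ measurableSet_Ioo subset_rfl).symm
    rw [h] at h'
    ext A hAm
    rw [← measure_inter_add_sdiff A (measurableSet_Ioo (a := (0 : ℝ)) (b := 1)),
      ← measure_inter_add_sdiff (μ := μ) A (measurableSet_Ioo (a := (0 : ℝ)) (b := 1)),
      measure_mono_null (sdiff_subset_compl A (Ioo 0 1)) (measure_compl_Ioo h),
      measure_mono_null (sdiff_subset_compl A (Ioo 0 1)) (measure_compl_Ioo h'),
      push_eq_Pop hA h (hAm.inter measurableSet_Ioo),
      H _ (hAm.inter measurableSet_Ioo) inter_subset_right]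
  · rw [← push_eq_Pop hA h hA', H]

lemma ext_of_integral_eq {μ ν : Measure ℝ} [IsProbabilityMeasure μ] [IsProbabilityMeasure ν]
    (hμ : μ (Ioo 0 1) = 1) (hν : ν (Ioo 0 1) = 1)
    (h : ∀ (φ : ℝ → ℝ) (M : ℝ), UniformContinuous φ → (∀ x, |φ x| ≤ M) →
      ∫ x, φ x ∂μ = ∫ x, φ x ∂ν) : μ = ν := by
  refine ext_of_forall_integral_eq_of_IsFiniteMeasure fun φ => ?_
  have key : ∀ ρ : Measure ℝ, IsProbabilityMeasure ρ → ρ (Ioo 0 1) = 1 →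
      ∫ x, φ x ∂ρ = ∫ x, φ (projIcc 0 1 zero_le_one x) ∂ρ := by
    intro ρ _ hρ
    refine integral_congr_ae ?_
    filter_upwards [ae_mem_Ioo hρ] with x hx
    rw [projIcc_of_mem zero_le_one (Ioo_subset_Icc_self hx)]
  rw [key μ ‹_› hμ, key ν ‹_› hν]
  refine h _ ‖φ‖ ?_ fun x => φ.norm_coe_le_norm _
  have h1 : UniformContinuous fun x : Icc (0 : ℝ) 1 => φ x :=
    CompactSpace.uniformContinuous_of_continuous (φ.continuous.comp continuous_subtype_val)
  exact h1.comp (LipschitzWith.projIcc zero_le_one).uniformContinuous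

lemma tendsto_iterate_avg_integral (hA1 : A1 x₀ y₀) (hA2 : A2 p₀ p₁) (hA3 : A3 p₀ p₁)
    (hA4 : A4 x₀ y₀ p₀ p₁) {μ : Measure ℝ} [IsProbabilityMeasure μ] (h : μ (Ioo 0 1) = 1)
    (hinv : push (weight p₀ p₁) (fb x₀ y₀) μ = μ) {φ : ℝ → ℝ} {M : ℝ}
    (hφ : UniformContinuous φ) (hM : ∀ x, |φ x| ≤ M) {x : ℝ} (hx : x ∈ Ioo (0 : ℝ) 1) :
    Tendsto (fun n => (avg (weight p₀ p₁) (fb x₀ y₀))^[n] φ x) atTop (𝓝 (∫ x, φ x ∂μ)) := by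
  obtain ⟨δ, hw⟩ := exists_isWeight hA3
  have hpm := measurable_weight hA3
  have hfm := measurable_fb hA1
  set u : ℕ → ℝ → ℝ := fun n => (avg (weight p₀ p₁) (fb x₀ y₀))^[n] φ with hu
  have hum : ∀ n, Measurable (u n) := measurable_iterate_avg hpm hfm hφ.continuous.measurable
  have huM : ∀ n z, |u n z| ≤ M := fun n z => abs_iterate_avg_le hw hM n z
  have hintegral : ∀ n, ∫ z, u n z ∂μ = ∫ z, φ z ∂μ := fun n => by
    rw [← integral_iterate_push hw hpm hfm μ hφ.continuous.measurable hM n,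
      Function.iterate_fixed hinv]
  have h0 : Tendsto (fun n => ∫ z, (u n z - u n x) ∂μ) atTop (𝓝 (∫ _, 0 ∂μ)) := by
    refine tendsto_integral_of_dominated_convergence (fun _ => 2 * M)
      (fun n => ((hum n).sub_const _).aestronglyMeasurable) (integrable_const _)
      (fun n => ae_of_all _ fun z => ?_) ?_
    · rw [Real.norm_eq_abs]
      linarith [abs_sub (u n z) (u n x), huM n z, huM n x]
    · filter_upwards [ae_mem_Ioo h] with z hz
      exact tendsto_iterate_avg_fb_sub hA1 hA2 hA3 hA4 hφ hM hz hx
  have h1 : ∀ n, ∫ z, (u n z - u n x) ∂μ = ∫ z, φ z ∂μ - u n x := fun n => by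
    rw [integral_sub (Integrable.of_bound (hum n).aestronglyMeasurable M
      (ae_of_all _ (huM n))) (integrable_const _), hintegral]
    simp
  simp only [h1, integral_zero] at h0
  simpa using h0.const_sub (∫ z, φ z ∂μ)

lemma stationary_unique (hA1 : A1 x₀ y₀) (hA2 : A2 p₀ p₁) (hA3 : A3 p₀ p₁)
    (hA4 : A4 x₀ y₀ p₀ p₁) {μ ν : Measure ℝ} (hμ : Stationary x₀ y₀ p₀ p₁ μ)
    (hν : Stationary x₀ y₀ p₀ p₁ ν) : μ = ν := by
  obtain ⟨_, hμ1, hμi⟩ := (stationary_iff hA1 hA3 μ).1 hμ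
  obtain ⟨_, hν1, hνi⟩ := (stationary_iff hA1 hA3 ν).1 hν
  refine ext_of_integral_eq hμ1 hν1 fun φ M hφ hM => ?_
  have hx : (1 / 2 : ℝ) ∈ Ioo (0 : ℝ) 1 := by constructor <;> norm_num
  exact tendsto_nhds_unique (tendsto_iterate_avg_integral hA1 hA2 hA3 hA4 hμ1 hμi hφ hM hx)
    (tendsto_iterate_avg_integral hA1 hA2 hA3 hA4 hν1 hνi hφ hM hx)

/-- The laws at time `n` started from a point of `(0, 1)` do not charge neighbourhoods of the
endpoints too much, uniformly in `n`. -/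
lemma exists_measure_compl_Icc_le (hA1 : A1 x₀ y₀) (hA3 : A3 p₀ p₁) (hA4 : A4 x₀ y₀ p₀ p₁)
    {x : ℝ} (hx : x ∈ Ioo (0 : ℝ) 1) {η : ℝ} (hη : 0 < η) :
    ∃ ε > 0, ∀ n, (push (weight p₀ p₁) (fb x₀ y₀))^[n] (Measure.dirac x) (Icc ε (1 - ε))ᶜ ≤
      ENNReal.ofReal η := by
  obtain ⟨δ, hw⟩ := exists_isWeight hA3
  obtain ⟨V, γ, C, hγ, hγ1, hC, hV0, hV, hVR⟩ := exists_lyapunov hA1 hA3 hA4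
  have h1 : 0 < 1 - γ := by linarith
  have hx0 := hV0 x
  set D := V x + C / (1 - γ) + 1 with hD
  have hDpos : 0 < D := by positivity
  obtain ⟨ε, hε, hεV⟩ := hVR (D / η)
  refine ⟨ε, hε, fun n => ?_⟩
  have hprob := isProbabilityMeasure_iterate_push hw (measurable_weight hA3) (measurable_fb hA1)
    (Measure.dirac x) n
  have hKm : MeasurableSet (Icc ε (1 - ε))ᶜ := measurableSet_Icc.compl
  have hψm : Measurable ((Icc ε (1 - ε))ᶜ.indicator (1 : ℝ → ℝ)) := measurable_one.indicator hKm
  have hψ1 : ∀ z, |(Icc ε (1 - ε))ᶜ.indicator (1 : ℝ → ℝ) z| ≤ 1 := fun z => by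
    by_cases hz : z ∈ (Icc ε (1 - ε))ᶜ <;> simp [hz]
  have hintegral := integral_iterate_push hw (measurable_weight hA3) (measurable_fb hA1)
    (Measure.dirac x) hψm hψ1 n
  rw [integral_indicator_one hKm, integral_dirac] at hintegral
  rw [← ENNReal.ofReal_toReal (measure_ne_top _ _)]
  refine ENNReal.ofReal_le_ofReal ?_
  rw [← measureReal_def, hintegral]
  refine (iterate_avg_le_of_lyapunov_on hw (fun b z hz => fb_mem hA1 b hz) hγ hγ1 hC
    (a := 0) (b := η / D) (by positivity) hV (fun z hz => ?_) n hx).trans ?_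
  · by_cases hzV : V z ≤ D / η
    · rw [indicator_of_notMem (by simpa using hεV z hz hzV)]
      have := hV0 z
      positivity
    · rw [not_le, div_lt_iff₀ hη] at hzV
      refine (indicator_le_self' (fun _ _ => zero_le_one) z).trans ?_
      change 1 ≤ 0 + η / D * V z
      rw [zero_add, div_mul_eq_mul_div, one_le_div hDpos]
      linarith
  · rw [zero_add, div_mul_eq_mul_div, div_le_iff₀ hDpos]
    refine mul_le_mul_of_nonneg_left ?_ hη.le
    have := mul_le_of_le_one_left hx0 (pow_le_one₀ hγ hγ1.le (n := n))
    linarith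

lemma exists_stationary (hA1 : A1 x₀ y₀) (hA2 : A2 p₀ p₁) (hA3 : A3 p₀ p₁)
    (hA4 : A4 x₀ y₀ p₀ p₁) : ∃ μ, Stationary x₀ y₀ p₀ p₁ μ := by
  obtain ⟨δ, hw⟩ := exists_isWeight hA3
  have hpm := measurable_weight hA3
  have hfm := measurable_fb hA1
  have hx : (1 / 2 : ℝ) ∈ Ioo (0 : ℝ) 1 := by constructor <;> norm_num
  set T := push (weight p₀ p₁) (fb x₀ y₀) with hT
  set G := avg (weight p₀ p₁) (fb x₀ y₀) with hG
  let m : ℕ → ProbabilityMeasure ℝ := fun n =>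
    ⟨T^[n] (Measure.dirac (1 / 2)), isProbabilityMeasure_iterate_push hw hpm hfm _ n⟩
  choose ε hε hεm using fun k : ℕ =>
    exists_measure_compl_Icc_le hA1 hA3 hA4 hx (Nat.one_div_pos_of_nat (α := ℝ) (n := k))
  have hu : Tendsto (fun k : ℕ => (1 / ((k : ℝ) + 1)).toNNReal) atTop (𝓝 0) := by
    simpa using tendsto_real_toNNReal (tendsto_one_div_add_atTop_nhds_zero_nat (𝕜 := ℝ))
  have hcomp := isCompact_setOfPred_probabilityMeasure_mass_eq_compl_isCompact_le hu
    (fun k => isCompact_Icc (a := ε k) (b := 1 - ε k)) (Or.inl inferInstance)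
  have hmem : ∀ n, m n ∈ {μ : ProbabilityMeasure ℝ |
      ∀ k : ℕ, μ (Icc (ε k) (1 - ε k))ᶜ ≤ (1 / ((k : ℝ) + 1)).toNNReal} := fun n k => by
    rw [← ENNReal.coe_le_coe, ProbabilityMeasure.ennreal_coeFn_eq_coeFn_toMeasure]
    exact hεm k n
  obtain ⟨μ, hμ, hlim⟩ := hcomp.ultrafilter_le_nhds ((hyperfilter ℕ).map m)
    (le_principal_iff.2 (Filter.mem_map.2 (univ_mem' hmem)))
  have hlim : Tendsto m (hyperfilter ℕ) (𝓝 μ) := hlim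
  have hμ0 : (μ : Measure ℝ) (Ioo 0 1)ᶜ = 0 := by
    have h1 : ∀ k : ℕ, (μ : Measure ℝ) (Ioo 0 1)ᶜ ≤ ((1 / ((k : ℝ) + 1)).toNNReal : ℝ≥0∞) := by
      intro k
      have h2 := ENNReal.coe_le_coe.2 (hμ k)
      rw [ProbabilityMeasure.ennreal_coeFn_eq_coeFn_toMeasure] at h2
      refine (measure_mono (compl_subset_compl.2 fun z hz => ?_)).trans h2
      have := hε k
      exact ⟨this.trans_le hz.1, hz.2.trans_lt (by linarith)⟩
    exact le_antisymm (ge_of_tendsto' (ENNReal.tendsto_coe.2 hu) h1) zero_le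
  have hμ1 : (μ : Measure ℝ) (Ioo 0 1) = 1 := (prob_compl_eq_zero_iff measurableSet_Ioo).1 hμ0
  have hTprob := isProbabilityMeasure_push hw hpm hfm (μ : Measure ℝ)
  have hTμ1 : T μ (Ioo 0 1) = 1 := (prob_compl_eq_zero_iff measurableSet_Ioo).1
    (push_apply_eq_zero hfm measurableSet_Ioo (fun b z hz => fb_mem hA1 b hz) hμ0)
  have hconv : ∀ (φ : ℝ → ℝ) (M : ℝ), Continuous φ → (∀ z, |φ z| ≤ M) →
      Tendsto (fun n => G^[n] φ (1 / 2)) (hyperfilter ℕ) (𝓝 (∫ z, φ z ∂(μ : Measure ℝ))) := by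
    intro φ M hφ hM
    have := ProbabilityMeasure.tendsto_iff_forall_integral_tendsto.1 hlim
      (BoundedContinuousFunction.ofNormedAddCommGroup φ hφ M hM)
    refine this.congr fun n => ?_
    refine (integral_iterate_push hw hpm hfm (Measure.dirac (1 / 2)) hφ.measurable hM n).trans ?_
    exact integral_dirac _ _
  refine ⟨μ, (stationary_iff hA1 hA3 _).2 ⟨inferInstance, hμ1, ?_⟩⟩
  refine ext_of_integral_eq hTμ1 hμ1 fun φ M hφ hM => ?_
  rw [integral_push hw hpm hfm _ hφ.continuous.measurable hM]
  have hGφ : Continuous (G φ) := continuous_finsetSum _ fun b _ =>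
    (continuous_weight hA3 b).mul (hφ.continuous.comp (continuous_fb hA1 b))
  have h1 := (hconv (G φ) M hGφ fun z => abs_iterate_avg_le hw hM 1 z).sub
    (hconv φ M hφ.continuous hM)
  have h2 : Tendsto (fun n => ∑ b, weight p₀ p₁ b (1 / 2) *
      (G^[n] φ (fb x₀ y₀ b (1 / 2)) - G^[n] φ (1 / 2))) (hyperfilter ℕ) (𝓝 (∑ b : Bool,
        weight p₀ p₁ b (1 / 2) * 0)) :=
    tendsto_finsetSum _ fun b _ => ((tendsto_iterate_avg_fb_sub hA1 hA2 hA3 hA4 hφ hM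
      (fb_mem hA1 b hx) hx).mono_left Nat.hyperfilter_le_atTop).const_mul _
  simp only [mul_zero, Finset.sum_const_zero] at h2
  refine sub_eq_zero.1 (tendsto_nhds_unique h1 (h2.congr fun n => ?_))
  rw [← Function.iterate_succ_apply, Function.iterate_succ_apply']
  simp only [mul_sub, Finset.sum_sub_distrib, ← Finset.sum_mul, hw.sum, one_mul, G, avg]

end Stationary

end AM

/-- Under (A1)–(A4) there exists a unique stationary Borel probability
measure `μ⋆` on (0,1), i.e. a unique Borel probability measure with `Pμ⋆ = μ⋆`. -/
theorem stmt0 (x₀ y₀ : ℝ) (p₀ p₁ : ℝ → ℝ)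
    (hA1 : AM.A1 x₀ y₀) (hA2 : AM.A2 p₀ p₁) (hA3 : AM.A3 p₀ p₁) (hA4 : AM.A4 x₀ y₀ p₀ p₁) :
    ∃! μ : MeasureTheory.Measure ℝ, AM.Stationary x₀ y₀ p₀ p₁ μ := by
  obtain ⟨μ, hμ⟩ := AM.exists_stationary hA1 hA2 hA3 hA4
  exact ⟨μ, hμ, fun ν hν => AM.stationary_unique hA1 hA2 hA3 hA4 hν hμ⟩
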